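/- arXiv:2404.10750 — 2 statements merged into one kernel-verified Lean document; each statement's English description precedes it below -/
import Mathlib

section
/- Let k be a positive integer, set s = ⌈k/12⌉, let T be an antidirected tree with k arcs, and let D be a 𝒦_{2,s}-free digraph with more than (k−1)·|V(D)| arcs. If Δ(T) > ⌊k/4⌋ and Δ₂(T) ≤ ⌊k/4⌋ + 2, then T embeds in D. -/
open Finset

section Defs

variable {V W : Type*}

/-- Number of arcs of a digraph given by a Boolean adjacency relation. -/
def arcCount [Fintype V] (A : V → V → Bool) : ℕ :=
  ((univ : Finset (V × V)).filter (fun p => A p.1 p.2)).card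

/-- Out-neighbourhood. -/
def outNbr [Fintype V] (A : V → V → Bool) (a : V) : Finset V :=
  univ.filter (fun v => A a v)

/-- In-neighbourhood. -/
def inNbr [Fintype V] (A : V → V → Bool) (a : V) : Finset V :=
  univ.filter (fun v => A v a)

/-- Neighbourhood with a sign: `true` = out, `false` = in. -/
def nbr [Fintype V] (A : V → V → Bool) (sign : Bool) (a : V) : Finset V :=
  if sign then outNbr A a else inNbr A a

/-- Total degree (out-degree plus in-degree). -/
def totalDeg [Fintype V] (A : V → V → Bool) (a : V) : ℕ :=
  (outNbr A a).card + (inNbr A a).card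

/-- Maximum total degree `Δ`. -/
def maxDeg [Fintype V] (A : V → V → Bool) : ℕ :=
  univ.sup (totalDeg A)

/-- Second largest element `Δ₂` of the multiset of total degrees. -/
def secondMaxDeg [Fintype V] (A : V → V → Bool) : ℕ :=
  (((univ : Finset V).val.map (totalDeg A)).erase (maxDeg A)).sup

/-- Loopless digraph. -/
def Loopless (A : V → V → Bool) : Prop := ∀ v, ¬ A v v

/-- Antidirected digraph: no directed path with two arcs. -/
def Antidirected (A : V → V → Bool) : Prop := ∀ x y z, A x y → A y z → False

/-- The underlying (undirected) simple graph of a digraph. -/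
def underG (A : V → V → Bool) : SimpleGraph V :=
  SimpleGraph.fromRel (fun x y => A x y)

/-- `𝒦_{2,s}`-freeness: no two distinct vertices `a`, `b` together with signs and `s`
distinct vertices (all different from `a` and `b`) lying in both signed neighbourhoods. -/
def K2sFree [Fintype V] [DecidableEq V] (A : V → V → Bool) (s : ℕ) : Prop :=
  ¬ ∃ (a b : V) (sa sb : Bool) (S : Finset V), a ≠ b ∧ S.card = s ∧
      a ∉ S ∧ b ∉ S ∧ S ⊆ nbr A sa a ∩ nbr A sb b

/-- `T` embeds in `A`: there is an injective arc-preserving map. -/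
def Embeds (T : W → W → Bool) (A : V → V → Bool) : Prop :=
  ∃ f : W → V, Function.Injective f ∧ ∀ x y, T x y → A (f x) (f y)

/-- Vertices of positive out-degree. -/
def outVerts [Fintype V] (A : V → V → Bool) : Finset V :=
  univ.filter (fun v => (outNbr A v).card ≠ 0)

/-- Vertices of positive in-degree. -/
def inVerts [Fintype V] (A : V → V → Bool) : Finset V :=
  univ.filter (fun v => (inNbr A v).card ≠ 0)

/-- A caterpillar: a tree with a path such that every vertex is on the path
or adjacent to it. -/
def IsCaterpillarG {X : Type*} (G : SimpleGraph X) : Prop :=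
  G.IsTree ∧ ∃ (x y : X) (P : G.Walk x y), P.IsPath ∧
    ∀ v, v ∈ P.support ∨ ∃ w ∈ P.support, G.Adj v w

/-- Minimum pseudo-semidegree at least `m`: at least one arc, and every
out-degree and in-degree is `0` or at least `m`. -/
def MinPseudoSemidegGe [Fintype V] (A : V → V → Bool) (m : ℕ) : Prop :=
  0 < arcCount A ∧ (∀ v, (outNbr A v).card = 0 ∨ m ≤ (outNbr A v).card) ∧
    (∀ v, (inNbr A v).card = 0 ∨ m ≤ (inNbr A v).card)

/-- `D'` is a subdigraph of `D` with vertex set `S`. -/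
def SubdigraphOn (D : V → V → Bool) (S : Finset V) (D' : V → V → Bool) : Prop :=
  ∀ x y, D' x y → D x y ∧ x ∈ S ∧ y ∈ S

/-- The vertex set of the double broom `B_{uv}(T)`: the path joining `u` and `v`
together with all neighbours of `u` and all neighbours of `v`. -/
def broomSet [Fintype W] [DecidableEq W] (T : W → W → Bool) {u v : W}
    (p : (underG T).Walk u v) : Finset W :=
  p.support.toFinset ∪ (outNbr T u ∪ inNbr T u) ∪ (outNbr T v ∪ inNbr T v)

/-- `z` lies strictly after `x` and strictly before `y` in clockwise (cyclic) order
on `Fin n`. -/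
def cycBetween {n : ℕ} (x y z : Fin n) : Prop :=
  if x < y then x < z ∧ z < y else x < z ∨ z < y

/-- An arc `pq` of the convex digraph `A` on `Fin n` is good for the antidirected
caterpillar `T` with final vertex `u`, its spine neighbour `v`, and spine with
`plen` edges (so `plen + 1` spine vertices). -/
def GoodArc {n : ℕ} (A : Fin n → Fin n → Bool) (T : W → W → Bool)
    (u v : W) (plen : ℕ) (pq : Fin n × Fin n) : Prop :=
  ∃ f : W → Fin n, Function.Injective f ∧ (∀ x y, T x y → A (f x) (f y)) ∧
    ((T v u = true ∧ (f v, f u) = pq) ∨ (T u v = true ∧ (f u, f v) = pq)) ∧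
    (∀ z : Fin n,
      (plen % 2 = 0 → cycBetween (f u) (f v) z → z ∉ Set.range f) ∧
      (plen % 2 = 1 → z ≠ f u → z ≠ f v → ¬ cycBetween (f u) (f v) z →
        z ∉ Set.range f))

/-- Number of edges of a bipartite graph with parts `α`, `β`. -/
def bipArcCount {α β : Type*} [Fintype α] [Fintype β] (E : α → β → Bool) : ℕ :=
  ((univ : Finset (α × β)).filter (fun p => E p.1 p.2)).card

/-- Degree of a vertex of the `α` part. -/
def bipDegA {α β : Type*} [Fintype β] (E : α → β → Bool) (a : α) : ℕ :=
  (univ.filter (fun b => E a b)).card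

/-- Degree of a vertex of the `β` part. -/
def bipDegB {α β : Type*} [Fintype α] (E : α → β → Bool) (b : β) : ℕ :=
  (univ.filter (fun a => E a b)).card

end Defs

section Candidates

variable {V W : Type*} [DecidableEq V] [DecidableEq W]

theorem three_mul_le_card_union {A B C : Finset V} {δ σ : ℕ}
    (hA : δ ≤ #A) (hB : δ ≤ #B) (hC : δ ≤ #C)
    (hAB : #(A ∩ B) ≤ σ) (hAC : #(A ∩ C) ≤ σ) (hBC : #(B ∩ C) ≤ σ) :
    3 * δ ≤ #(A ∪ B ∪ C) + 3 * σ := by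
  have h₁ := card_union_add_card_inter A B
  have h₂ := card_union_add_card_inter (A ∪ B) C
  have h₃ : #((A ∪ B) ∩ C) ≤ #(A ∩ C) + #(B ∩ C) := by
    rw [union_inter_distrib_right]; exact card_union_le _ _
  omega

theorem four_mul_le_card_union {A B C E : Finset V} {δ σ : ℕ}
    (hA : δ ≤ #A) (hB : δ ≤ #B) (hC : δ ≤ #C) (hE : δ ≤ #E)
    (hAB : #(A ∩ B) ≤ σ) (hAC : #(A ∩ C) ≤ σ) (hBC : #(B ∩ C) ≤ σ)
    (hAE : #(A ∩ E) ≤ σ) (hBE : #(B ∩ E) ≤ σ) (hCE : #(C ∩ E) ≤ σ) :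
    4 * δ ≤ #(A ∪ B ∪ C ∪ E) + 6 * σ := by
  have h₁ := three_mul_le_card_union hA hB hC hAB hAC hBC
  have h₂ := card_union_add_card_inter (A ∪ B ∪ C) E
  have h₃ : #((A ∪ B ∪ C) ∩ E) ≤ #(A ∩ E) + #(B ∩ E) + #(C ∩ E) := by
    rw [union_inter_distrib_right, union_inter_distrib_right]
    exact (card_union_le _ _).trans (Nat.add_le_add_right (card_union_le _ _) _)
  omega

theorem card_le_card_sdiff_add (A U : Finset V) : #A ≤ #(A \ U) + #U := by
  have := card_sdiff_add_card A U
  have := card_le_card (subset_union_left : A ⊆ A ∪ U)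
  omega

/-- Tight sets of size at most two are closed under union, so there is a largest one. -/
theorem exists_largest_tight (S : Finset W) (A : W → Finset V) (wt : W → ℕ) (U : Finset V)
    (x₀ : W) (δ σ : ℕ) (hA : ∀ x ∈ S, δ ≤ #(A x))
    (hAA : ∀ x ∈ S, ∀ y ∈ S, x ≠ y → #(A x ∩ A y) ≤ σ)
    (hP : ∀ X ⊆ S, #X ≤ 2 → ∑ x ∈ X, wt x ≤ #(X.biUnion A \ U))
    (hlarge : ∀ X ⊆ S.erase x₀, 3 ≤ #X → #X ≤ 4 → #U + ∑ x ∈ X, wt x + 3 * σ < 3 * δ) :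
    ∃ Y ⊆ S.erase x₀, #Y ≤ 2 ∧ #(Y.biUnion A \ U) = ∑ x ∈ Y, wt x ∧
      ∀ X ⊆ S.erase x₀, #X ≤ 2 → #(X.biUnion A \ U) = ∑ x ∈ X, wt x → X ⊆ Y := by
  classical
  set F := (S.erase x₀).powerset.filter
    (fun X => #X ≤ 2 ∧ #(X.biUnion A \ U) = ∑ x ∈ X, wt x) with hF
  have hFne : F.Nonempty := ⟨∅, by simp [hF]⟩
  obtain ⟨Y, hY, hmax⟩ := exists_max_image F card hFne
  rw [hF, mem_filter, mem_powerset] at hY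
  refine ⟨Y, hY.1, hY.2.1, hY.2.2, fun X hX hX2 hXt => ?_⟩
  have hsub : X ∪ Y ⊆ S.erase x₀ := union_subset hX hY.1
  have hS : S.erase x₀ ⊆ S := erase_subset _ _
  have hsum := sum_union_inter (s₁ := X) (s₂ := Y) (f := wt)
  have hinter := hP (X ∩ Y) ((inter_subset_left.trans hX).trans hS)
    ((card_le_card inter_subset_left).trans hX2)
  have hcard : #((X ∪ Y).biUnion A \ U) ≤ ∑ x ∈ X ∪ Y, wt x := by
    have h₁ := card_union_add_card_inter (X.biUnion A \ U) (Y.biUnion A \ U)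
    have h₂ : (X ∪ Y).biUnion A \ U = (X.biUnion A \ U) ∪ (Y.biUnion A \ U) := by
      rw [union_biUnion, union_sdiff_distrib]
    have h₃ : (X ∩ Y).biUnion A \ U ⊆ (X.biUnion A \ U) ∩ (Y.biUnion A \ U) := by
      intro z hz
      simp only [mem_sdiff, mem_biUnion, mem_inter] at hz ⊢
      obtain ⟨⟨x, hx, hz⟩, hU⟩ := hz
      exact ⟨⟨⟨x, hx.1, hz⟩, hU⟩, ⟨x, hx.2, hz⟩, hU⟩
    have h₄ := card_le_card h₃
    rw [h₂]
    omega
  have hXY : #(X ∪ Y) ≤ 2 := by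
    by_contra h3
    have h4 : #(X ∪ Y) ≤ 4 := (card_union_le _ _).trans (by omega)
    have hl := hlarge _ hsub (by omega) h4
    obtain ⟨a, b, c, ha, hb, hc, hab, hac, hbc⟩ := two_lt_card_iff.mp (by omega : 2 < #(X ∪ Y))
    have hs : ∀ {a}, a ∈ X ∪ Y → a ∈ S := fun h => hS (hsub h)
    have h₁ := three_mul_le_card_union (hA a (hs ha)) (hA b (hs hb)) (hA c (hs hc))
      (hAA _ (hs ha) _ (hs hb) hab) (hAA _ (hs ha) _ (hs hc) hac) (hAA _ (hs hb) _ (hs hc) hbc)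
    have h₂ : A a ∪ A b ∪ A c ⊆ (X ∪ Y).biUnion A :=
      union_subset (union_subset (subset_biUnion_of_mem A ha) (subset_biUnion_of_mem A hb))
        (subset_biUnion_of_mem A hc)
    have h₃ := card_le_card h₂
    have h₄ := card_le_card_sdiff_add ((X ∪ Y).biUnion A) U
    omega
  have hmem : X ∪ Y ∈ F := by
    rw [hF, mem_filter, mem_powerset]
    exact ⟨hsub, hXY, le_antisymm hcard (hP _ (hsub.trans hS) hXY)⟩
  have heq : Y = X ∪ Y := eq_of_subset_of_card_le subset_union_right (hmax _ hmem)
  rw [heq]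
  exact subset_union_left

/-- The selection step: among the free neighbours `A x₀ \ U` of an embedded vertex there is one
whose own neighbourhood `B z` is large enough and which keeps all Hall-type conditions for sets of
at most two embedded vertices. -/
theorem exists_good_candidate (S : Finset W) (A : W → Finset V) (wt : W → ℕ) (U : Finset V)
    (x₀ : W) (hx₀ : x₀ ∈ S) (B : V → Finset V) (l δ σ : ℕ) (hA : ∀ x ∈ S, δ ≤ #(A x))
    (hAA : ∀ x ∈ S, ∀ y ∈ S, x ≠ y → #(A x ∩ A y) ≤ σ)
    (hB : ∀ z ∈ A x₀ \ U, δ ≤ #(B z)) (hself : ∀ z, z ∉ B z)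
    (hBA : ∀ z ∈ A x₀ \ U, ∀ x ∈ S, #(B z ∩ A x) ≤ σ)
    (hBB : ∀ z z', z ≠ z' → #(B z ∩ B z') ≤ σ)
    (hP : ∀ X ⊆ S, #X ≤ 2 → ∑ x ∈ X, wt x ≤ #(X.biUnion A \ U)) (hw : 2 ≤ wt x₀)
    (h_one : ∀ y ∈ S, #U + wt y + 2 * l + 3 * σ ≤ 3 * δ)
    (h_two : ∀ y ∈ S, ∀ y' ∈ S, y ≠ y' → #U + wt y + wt y' + 2 * l + 6 * σ < 4 * δ)
    (h_zero : #U + 3 * l + 3 * σ < 3 * δ + 3)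
    (h_pair : ∀ X ⊆ S.erase x₀, #X = 2 → #U + ∑ x ∈ X, wt x + 3 + 3 * σ ≤ 3 * δ)
    (hlarge : ∀ X ⊆ S.erase x₀, 3 ≤ #X → #X ≤ 4 → #U + ∑ x ∈ X, wt x + 3 * σ < 3 * δ) :
    ∃ z ∈ A x₀ \ U,
      (∀ X ⊆ S.erase x₀, #X ≤ 2 → #(X.biUnion A \ U) = ∑ x ∈ X, wt x → z ∉ X.biUnion A) ∧
      l ≤ #(B z \ U) ∧
      (∀ y ∈ S, y ≠ x₀ → l + wt y ≤ #((B z ∪ A y) \ insert z U)) ∧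
      l + wt x₀ ≤ #((B z ∪ A x₀) \ U) := by
  classical
  obtain ⟨Y, hYS, hY2, hYt, hYmax⟩ := exists_largest_tight S A wt U x₀ δ σ hA hAA hP hlarge
  set C := (A x₀ \ U) \ Y.biUnion A with hC
  have hCsub : ∀ z ∈ C, z ∈ A x₀ \ U := fun z hz => (mem_sdiff.mp hz).1
  have hsingle : ∀ y ∈ S, wt y ≤ #(A y \ U) := fun y hy => by
    simpa using hP {y} (by simpa using hy) (by simp)
  have split : ∀ z y, #((B z ∪ A y) \ U) = #((B z \ U) \ A y) + #(A y \ U) := by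
    intro z y
    rw [← card_union_of_disjoint]
    · congr 1; ext t; simp only [mem_sdiff, mem_union]; tauto
    · rw [disjoint_left]; intro t; simp only [mem_sdiff]; tauto
  by_contra! hcon
  -- every candidate outside the largest tight set is defective
  have hbad : ∀ z ∈ C, #(B z \ U) < l ∨
      ∃ y ∈ S, #((B z ∪ A y) \ U) ≤ l + wt y ∧ #((B z \ U) \ A y) < l := by
    intro z hz
    by_cases hs : #(B z \ U) < l
    · exact Or.inl hs
    right
    by_contra! hno
    have hzY : z ∉ Y.biUnion A := (mem_sdiff.mp hz).2
    have := hcon z (hCsub z hz)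
      (fun X hX hX2 hXt hzX => hzY (biUnion_subset_biUnion_of_subset_left A (hYmax X hX hX2 hXt) hzX))
      (by omega) ?_
    · have h₁ := hno x₀ hx₀ (by omega)
      have h₂ := split z x₀
      have h₃ := hsingle x₀ hx₀
      omega
    intro y hy hyx
    have h₁ := hno y hy
    have h₂ := split z y
    have h₃ := hsingle y hy
    have h₄ : #((B z ∪ A y) \ U) ≤ #((B z ∪ A y) \ insert z U) + 1 := by
      have : (B z ∪ A y) \ insert z U = ((B z ∪ A y) \ U).erase z := by
        ext t; simp only [mem_sdiff, mem_insert, mem_erase]; tauto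
      rw [this]
      have := pred_card_le_card_erase (s := (B z ∪ A y) \ U) (a := z)
      omega
    by_cases ht : #(A y \ U) = wt y
    · have hyY : y ∈ Y := by
        have := hYmax {y} (by simpa using ⟨hyx, hy⟩) (by simp) (by simpa using ht)
        simpa using this
      have hzA : z ∉ A y := fun h => hzY (mem_biUnion.mpr ⟨y, hyY, h⟩)
      have : (B z ∪ A y) \ insert z U = (B z ∪ A y) \ U := by
        ext t
        simp only [mem_sdiff, mem_insert, mem_union]
        constructor
        · tauto
        · rintro ⟨h, hU⟩
          refine ⟨h, ?_⟩
          rintro (rfl | h')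
          · exact h.elim (hself _) hzA
          · exact hU h'
      rw [this]
      by_contra! hlt
      have := h₁ (by omega)
      omega
    · by_contra! hlt
      have := h₁ (by omega)
      omega
  have sub3 : ∀ P Q R : Finset V, #(P ∪ Q ∪ R) ≤ #((P ∪ Q) \ U) + #(R \ U) + #U := by
    intro P Q R
    have h₁ := card_le_card_sdiff_add (P ∪ Q ∪ R) U
    rw [union_sdiff_distrib] at h₁
    have := card_union_le ((P ∪ Q) \ U) (R \ U)
    omega
  -- two defective candidates both have few free neighbours
  have htwo : ∀ z₁ ∈ C, ∀ z₂ ∈ C, z₁ ≠ z₂ → #(B z₁ \ U) < l := by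
    intro z₁ hz₁ z₂ hz₂ hne
    by_contra hs
    obtain ⟨y, hy, h₁, h₁'⟩ := (hbad z₁ hz₁).resolve_left hs
    have m₁ := hCsub z₁ hz₁
    have m₂ := hCsub z₂ hz₂
    have h3 := three_mul_le_card_union (hB z₁ m₁) (hA y hy) (hB z₂ m₂) (hBA z₁ m₁ y hy)
      (hBB _ _ hne) (by rw [inter_comm]; exact hBA z₂ m₂ y hy)
    have hone := h_one y hy
    rcases hbad z₂ hz₂ with h₂ | ⟨y', hy', h₂, h₂'⟩
    · have := sub3 (B z₁) (A y) (B z₂)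
      omega
    · by_cases hyy : y = y'
      · subst hyy
        have h₅ : (B z₁ ∪ A y ∪ B z₂) \ U ⊆ ((B z₁ ∪ A y) \ U) ∪ ((B z₂ \ U) \ A y) := by
          intro t; simp only [mem_sdiff, mem_union]; tauto
        have h₆ := (card_le_card h₅).trans (card_union_le _ _)
        have h₇ := card_le_card_sdiff_add (B z₁ ∪ A y ∪ B z₂) U
        omega
      · have h4 := four_mul_le_card_union (hB z₁ m₁) (hA y hy) (hB z₂ m₂) (hA y' hy')
          (hBA z₁ m₁ y hy) (hBB _ _ hne) (by rw [inter_comm]; exact hBA z₂ m₂ y hy)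
          (hBA z₁ m₁ y' hy') (hAA y hy y' hy' hyy) (hBA z₂ m₂ y' hy')
        have h₅ : (B z₁ ∪ A y ∪ B z₂ ∪ A y') \ U ⊆
            ((B z₁ ∪ A y) \ U) ∪ ((B z₂ ∪ A y') \ U) := by
          intro t; simp only [mem_sdiff, mem_union]; tauto
        have h₆ := (card_le_card h₅).trans (card_union_le _ _)
        have h₇ := card_le_card_sdiff_add (B z₁ ∪ A y ∪ B z₂ ∪ A y') U
        have := h_two y hy y' hy' hyy
        omega
  have hC3 : ¬ 3 ≤ #C := by
    intro h3
    obtain ⟨a, b, c, ha, hb, hc, hab, hac, hbc⟩ := two_lt_card_iff.mp (by omega : 2 < #C)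
    have h₁ := three_mul_le_card_union (hB a (hCsub a ha)) (hB b (hCsub b hb)) (hB c (hCsub c hc))
      (hBB _ _ hab) (hBB _ _ hac) (hBB _ _ hbc)
    have h₂ := sub3 (B a) (B b) (B c)
    have h₃ : #((B a ∪ B b) \ U) ≤ #(B a \ U) + #(B b \ U) := by
      rw [union_sdiff_distrib]; exact card_union_le _ _
    have := htwo a ha b hb hab
    have := htwo b hb a ha hab.symm
    have := htwo c hc a ha hac.symm
    omega
  have hCY : ∀ X : Finset V, #(A x₀ ∪ X) ≤ #((A x₀ \ U) \ X) + #(X \ U) + #U := by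
    intro X
    have h₁ : (A x₀ ∪ X) \ U ⊆ ((A x₀ \ U) \ X) ∪ (X \ U) := by
      intro t; simp only [mem_sdiff, mem_union]; tauto
    have h₂ := (card_le_card h₁).trans (card_union_le _ _)
    have h₃ := card_le_card_sdiff_add (A x₀ ∪ X) U
    omega
  have hC2 : 2 ≤ #Y ∨ 2 ≤ #C := by
    by_contra! h
    have hx₀Y : x₀ ∉ Y := fun h' => by simpa using hYS h'
    have h₁ := hP (insert x₀ Y) (insert_subset hx₀ (hYS.trans (erase_subset _ _)))
      (by rw [card_insert_of_notMem hx₀Y]; omega)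
    rw [sum_insert hx₀Y, biUnion_insert] at h₁
    have h₂ : (A x₀ ∪ Y.biUnion A) \ U ⊆ C ∪ (Y.biUnion A \ U) := by
      intro t; simp only [hC, mem_sdiff, mem_union]; tauto
    have h₃ := (card_le_card h₂).trans (card_union_le _ _)
    omega
  by_cases hY : #Y = 2
  · obtain ⟨s, t, hst, rfl⟩ := card_eq_two.mp hY
    have hs := hYS (mem_insert_self s {t})
    have ht := hYS (mem_insert_of_mem (mem_singleton_self t) : t ∈ ({s, t} : Finset W))
    rw [mem_erase] at hs ht
    have h₁ := three_mul_le_card_union (hA x₀ hx₀) (hA s hs.2) (hA t ht.2)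
      (hAA _ hx₀ _ hs.2 hs.1.symm) (hAA _ hx₀ _ ht.2 ht.1.symm) (hAA _ hs.2 _ ht.2 hst)
    have h₂ := hCY (({s, t} : Finset W).biUnion A)
    have h₃ : A x₀ ∪ ({s, t} : Finset W).biUnion A = A x₀ ∪ A s ∪ A t := by
      rw [biUnion_insert, singleton_biUnion, union_assoc]
    rw [h₃, ← hC] at h₂
    have := h_pair _ hYS hY
    omega
  · obtain ⟨a, ha, b, hb, hab⟩ := one_lt_card.mp (by omega : 1 < #C)
    have ba := htwo a ha b hb hab
    have bb := htwo b hb a ha hab.symm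
    have h₃ : #((B a ∪ B b) \ U) ≤ #(B a \ U) + #(B b \ U) := by
      rw [union_sdiff_distrib]; exact card_union_le _ _
    have key : ∀ y ∈ S, 3 * δ ≤ #(A y \ U) + #U + 3 * σ + 2 * l - 2 := by
      intro y hy
      have h₁ := three_mul_le_card_union (hB a (hCsub a ha)) (hB b (hCsub b hb)) (hA y hy)
        (hBB _ _ hab) (hBA a (hCsub a ha) y hy) (hBA b (hCsub b hb) y hy)
      have h₂ := sub3 (B a) (B b) (A y)
      omega
    by_cases hY0 : Y = ∅
    · have h₁ := key x₀ hx₀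
      have h₂ := h_one x₀ hx₀
      have h₄ : C = A x₀ \ U := by rw [hC, hY0]; simp
      rw [h₄] at hC3
      omega
    · have hY1 : #Y = 1 := by
        have := card_pos.mpr (nonempty_iff_ne_empty.mpr hY0)
        omega
      obtain ⟨t, rfl⟩ := card_eq_one.mp hY1
      have ht : t ∈ S := mem_of_mem_erase (hYS (mem_singleton_self t))
      have h₁ := key t ht
      have h₂ := h_one t ht
      simp only [singleton_biUnion, sum_singleton] at hYt
      omega

end Candidates

section Extend

variable {V W : Type*} [DecidableEq V] [DecidableEq W]

/-- Hall-type conditions for sets of at most two vertices survive the embedding of a vertex `q`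
at a good candidate `z`. -/
theorem pair_condition_extend (S : Finset W) (A A' : W → Finset V) (wt wt' : W → ℕ)
    (U : Finset V) (x₀ : W) (hx₀ : x₀ ∈ S) (q : W) (hq : q ∉ S) (z : V) (l : ℕ)
    (hA' : ∀ x ∈ S, A' x = A x) (hself : z ∉ A' q)
    (hP : ∀ X ⊆ S, #X ≤ 2 → ∑ x ∈ X, wt x ≤ #(X.biUnion A \ U))
    (hwt : ∀ x ∈ S, wt' x ≤ wt x) (hwt₀ : wt' x₀ + 1 ≤ wt x₀) (hwtq : wt' q ≤ l)
    (htight : ∀ X ⊆ S.erase x₀, #X ≤ 2 → #(X.biUnion A \ U) = ∑ x ∈ X, wt x → z ∉ X.biUnion A)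
    (hl : l ≤ #(A' q \ U))
    (hpair : ∀ y ∈ S, y ≠ x₀ → l + wt y ≤ #((A' q ∪ A y) \ insert z U))
    (hpair₀ : l + wt x₀ ≤ #((A' q ∪ A x₀) \ U)) :
    ∀ X ⊆ insert q S, #X ≤ 2 → ∑ x ∈ X, wt' x ≤ #(X.biUnion A' \ insert z U) := by
  classical
  have hdrop : ∀ Y : Finset V, #(Y \ U) ≤ #(Y \ insert z U) + 1 := by
    intro Y
    have : Y \ insert z U = (Y \ U).erase z := by
      ext t; simp only [mem_sdiff, mem_insert, mem_erase]; tauto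
    rw [this]
    have := pred_card_le_card_erase (s := Y \ U) (a := z)
    omega
  have hsame : ∀ Y : Finset V, z ∉ Y → Y \ insert z U = Y \ U := by
    intro Y hz
    ext t
    simp only [mem_sdiff, mem_insert]
    constructor
    · tauto
    · rintro ⟨h, hU⟩
      exact ⟨h, by rintro (rfl | h'); exacts [hz h, hU h']⟩
  intro X hX hX2
  by_cases hqX : q ∈ X
  · obtain ⟨Y, hqY, rfl⟩ : ∃ Y, q ∉ Y ∧ insert q Y = X :=
      ⟨X.erase q, notMem_erase _ _, insert_erase hqX⟩
    rw [card_insert_of_notMem hqY] at hX2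
    have hYS : Y ⊆ S := by
      intro y hy
      rcases mem_insert.mp (hX (mem_insert_of_mem hy)) with rfl | h
      · exact absurd hy hqY
      · exact h
    rw [sum_insert hqY, biUnion_insert]
    rcases Nat.le_one_iff_eq_zero_or_eq_one.mp (by omega : #Y ≤ 1) with h | h
    · obtain rfl := card_eq_zero.mp h
      simp only [sum_empty, biUnion_empty, union_empty, add_zero]
      rw [hsame _ hself]
      omega
    · obtain ⟨y, rfl⟩ := card_eq_one.mp h
      have hy : y ∈ S := hYS (mem_singleton_self y)
      rw [sum_singleton, singleton_biUnion, hA' y hy]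
      by_cases hyx : y = x₀
      · subst hyx
        have := hdrop (A' q ∪ A y)
        omega
      · have := hpair y hy hyx
        have := hwt y hy
        omega
  · have hXS : X ⊆ S := fun x hx => (mem_insert.mp (hX hx)).resolve_left (fun h => hqX (h ▸ hx))
    have hbi : X.biUnion A' = X.biUnion A := biUnion_congr rfl (fun x hx => hA' x (hXS hx))
    rw [hbi]
    have h₁ := hP X hXS hX2
    have h₂ := hdrop (X.biUnion A)
    have h₃ : ∑ x ∈ X, wt' x ≤ ∑ x ∈ X, wt x := sum_le_sum fun x hx => hwt x (hXS hx)
    by_cases hx : x₀ ∈ X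
    · have := sum_lt_sum (fun x hx => hwt x (hXS hx)) ⟨x₀, hx, hwt₀⟩
      omega
    · by_cases ht : #(X.biUnion A \ U) = ∑ x ∈ X, wt x
      · rw [hsame _ (htight X (subset_erase.mpr ⟨hXS, hx⟩) hX2 ht)]
        omega
      · omega

end Extend

/-- A finite rooted tree given by its parent function. -/
structure ParentTree (W : Type*) where
  verts : Finset W
  root : W
  par : W → W
  rk : W → ℕ
  root_mem : root ∈ verts
  par_mem : ∀ w ∈ verts, w ≠ root → par w ∈ verts
  rk_par : ∀ w ∈ verts, w ≠ root → rk (par w) < rk w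

namespace ParentTree

variable {W : Type*} [DecidableEq W] (T : ParentTree W)

/-- The children of a vertex. -/
def ch (x : W) : Finset W := T.verts.filter (fun w => w ≠ T.root ∧ T.par w = x)

/-- A set of vertices that contains the root and is closed under taking parents. -/
structure IsInitial (S : Finset W) : Prop where
  subset : S ⊆ T.verts
  root_mem : T.root ∈ S
  par_mem : ∀ w ∈ S, w ≠ T.root → T.par w ∈ S

variable {T}

theorem mem_ch {x w : W} : w ∈ T.ch x ↔ w ∈ T.verts ∧ w ≠ T.root ∧ T.par w = x := by
  simp [ch]

theorem notMem_ch_self {x : W} : x ∉ T.ch x := by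
  intro h
  obtain ⟨h₁, h₂, h₃⟩ := mem_ch.mp h
  have := T.rk_par x h₁ h₂
  rw [h₃] at this
  exact lt_irrefl _ this

theorem sum_card_ch (S : Finset W) :
    ∑ x ∈ S, #(T.ch x) = #((T.verts.erase T.root).filter (fun w => T.par w ∈ S)) := by
  rw [card_eq_sum_card_fiberwise (f := T.par) (t := S)
    (s := (T.verts.erase T.root).filter (fun w => T.par w ∈ S)) (fun w hw => (mem_filter.mp hw).2)]
  refine sum_congr rfl fun x hx => ?_
  congr 1
  ext w
  simp only [mem_ch, mem_filter, mem_erase]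
  constructor
  · rintro ⟨h₁, h₂, rfl⟩; exact ⟨⟨⟨h₂, h₁⟩, hx⟩, rfl⟩
  · rintro ⟨⟨⟨h₂, h₁⟩, _⟩, rfl⟩; exact ⟨h₁, h₂, rfl⟩

theorem sum_card_ch_lt (S : Finset W) : ∑ x ∈ S, #(T.ch x) < #T.verts := by
  rw [sum_card_ch]
  have := card_le_card (filter_subset (fun w => T.par w ∈ S) (T.verts.erase T.root))
  rw [card_erase_of_mem T.root_mem] at this
  have := card_pos.mpr ⟨_, T.root_mem⟩
  omega

theorem IsInitial.card_add_sum {S : Finset W} (hS : T.IsInitial S) :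
    #S + ∑ x ∈ S, #(T.ch x \ S) = 1 + ∑ x ∈ S, #(T.ch x) := by
  have h₁ : ∀ x, #(T.ch x) = #(T.ch x ∩ S) + #(T.ch x \ S) := fun x => by
    rw [add_comm, card_sdiff_add_card_inter]
  have h₂ : ∑ x ∈ S, #(T.ch x ∩ S) = #(S.erase T.root) := by
    rw [card_eq_sum_card_fiberwise (f := T.par) (t := S)
      (fun w hw => hS.par_mem w (mem_erase.mp hw).2 (mem_erase.mp hw).1)]
    refine sum_congr rfl fun x hx => ?_
    congr 1
    ext w
    simp only [mem_ch, mem_inter, mem_filter, mem_erase]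
    constructor
    · rintro ⟨⟨h₁, h₂, h₃⟩, h₄⟩; exact ⟨⟨h₂, h₄⟩, h₃⟩
    · rintro ⟨⟨h₂, h₄⟩, h₃⟩; exact ⟨⟨hS.subset h₄, h₂, h₃⟩, h₄⟩
  rw [card_erase_of_mem hS.root_mem] at h₂
  have h₃ := card_pos.mpr ⟨_, hS.root_mem⟩
  simp only [h₁, sum_add_distrib]
  omega

theorem IsInitial.disjoint_ch {S : Finset W} (hS : T.IsInitial S) {q : W} (hq : q ∉ S) :
    Disjoint S (T.ch q) := by
  rw [disjoint_left]
  intro w hw hwq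
  obtain ⟨_, h₂, rfl⟩ := mem_ch.mp hwq
  exact hq (hS.par_mem w hw h₂)

theorem IsInitial.insert_next {S : Finset W} (hS : T.IsInitial S) {q : W} (hq : q ∈ T.verts)
    (hp : T.par q ∈ S) : T.IsInitial (insert q S) where
  subset := insert_subset hq hS.subset
  root_mem := mem_insert_of_mem hS.root_mem
  par_mem w hw hwr := by
    rcases mem_insert.mp hw with rfl | h
    · exact mem_insert_of_mem hp
    · exact mem_insert_of_mem (hS.par_mem w h hwr)

/-- A missing vertex with property `p`, if `p` is inherited by parents, can be chosen with its
parent present. -/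
theorem IsInitial.exists_next {S : Finset W} (hS : T.IsInitial S) {q : W} (hq : q ∈ T.verts)
    (hqS : q ∉ S) : ∃ q' ∈ T.verts, q' ∉ S ∧ T.par q' ∈ S ∧ (q' = q ∨ (T.ch q').Nonempty) := by
  obtain ⟨q', hq', hmin⟩ := exists_min_image
    ((T.verts \ S).filter (fun w => w = q ∨ (T.ch w).Nonempty)) T.rk
    ⟨q, by simp [hq, hqS]⟩
  simp only [mem_filter, mem_sdiff] at hq' hmin
  obtain ⟨⟨h₁, h₂⟩, h₃⟩ := hq'
  refine ⟨q', h₁, h₂, ?_, h₃⟩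
  have hr : q' ≠ T.root := fun h => h₂ (h ▸ hS.root_mem)
  by_contra hpar
  have hlt := T.rk_par q' h₁ hr
  have := hmin (T.par q') ⟨⟨T.par_mem q' h₁ hr, hpar⟩, Or.inr ⟨q', mem_ch.mpr ⟨h₁, hr, rfl⟩⟩⟩
  omega

/-- Number of unembedded children, plus one if no child can be postponed to the end. -/
def wt (T : ParentTree W) (S : Finset W) (x : W) : ℕ :=
  #(T.ch x \ S) +
    if x ≠ T.root ∧ (T.ch x \ S).Nonempty ∧ ∀ w ∈ T.ch x, (T.ch w).Nonempty then 1 else 0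

theorem wt_le (S : Finset W) (x : W) : T.wt S x ≤ #(T.ch x \ S) + 1 := by
  unfold wt; split_ifs <;> omega

theorem wt_root (S : Finset W) : T.wt S T.root = #(T.ch T.root \ S) := by
  simp [wt]

theorem wt_insert_of_ne {S : Finset W} {q x : W} (hx : x ≠ T.par q) :
    T.wt (insert q S) x = T.wt S x := by
  have : T.ch x \ insert q S = T.ch x \ S := by
    ext w
    simp only [mem_sdiff, mem_insert, mem_ch]
    constructor
    · tauto
    · rintro ⟨⟨h₁, h₂, rfl⟩, h₄⟩
      refine ⟨⟨h₁, h₂, rfl⟩, ?_⟩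
      rintro (rfl | h)
      exacts [hx rfl, h₄ h]
  rw [wt, wt, this]

theorem wt_insert_par {S : Finset W} {q : W} (hq : q ∈ T.verts) (hqr : q ≠ T.root) (hqS : q ∉ S) :
    T.wt (insert q S) (T.par q) + 1 ≤ T.wt S (T.par q) := by
  have hmem : q ∈ T.ch (T.par q) \ S := mem_sdiff.mpr ⟨mem_ch.mpr ⟨hq, hqr, rfl⟩, hqS⟩
  have h₁ : T.ch (T.par q) \ insert q S = (T.ch (T.par q) \ S).erase q := by
    ext w
    simp only [mem_sdiff, mem_insert, mem_erase]
    tauto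
  have h₂ := card_erase_add_one hmem
  have h₃ : (T.ch (T.par q) \ S).Nonempty := ⟨q, hmem⟩
  unfold wt
  rw [h₁]
  split_ifs with h₄ h₅ <;> first | omega | (exfalso; tauto)

theorem two_le_wt_par {S : Finset W} {q : W} (hq : q ∈ T.verts) (hqr : q ≠ T.root)
    (hqS : q ∉ S) (hch : (T.ch q).Nonempty) (hpr : T.par q ≠ T.root)
    (hS : ∀ x ∈ S, (T.ch x).Nonempty) : 2 ≤ T.wt S (T.par q) := by
  have hmem : q ∈ T.ch (T.par q) \ S := mem_sdiff.mpr ⟨mem_ch.mpr ⟨hq, hqr, rfl⟩, hqS⟩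
  have h₂ : 0 < #(T.ch (T.par q) \ S) := card_pos.mpr ⟨q, hmem⟩
  unfold wt
  split_ifs with h
  · omega
  · have : ∃ w ∈ T.ch (T.par q), ¬ (T.ch w).Nonempty := by
      by_contra! hcon
      exact h ⟨hpr, ⟨q, hmem⟩, hcon⟩
    obtain ⟨w, hw, hw'⟩ := this
    have : 1 < #(T.ch (T.par q) \ S) :=
      one_lt_card.mpr ⟨q, hmem, w, mem_sdiff.mpr ⟨hw, fun h => hw' (hS w h)⟩,
        fun h => hw' (h ▸ hch)⟩
    omega

/-- The weight of a fresh vertex `q`, and the room it takes in the tree. -/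
theorem exists_wt_eq_add {S : Finset W} (hS : T.IsInitial S) {q : W} (hq : q ∉ S) :
    ∃ κ ≤ 1, T.wt (insert q S) q = #(T.ch q) + κ ∧
      ∑ x ∈ S, #(T.ch x) + #(T.ch q) * (1 + κ) < #T.verts := by
  have h₁ : T.ch q \ insert q S = T.ch q := by
    rw [_root_.sdiff_eq_self_iff_disjoint, disjoint_insert_left]
    exact ⟨notMem_ch_self, hS.disjoint_ch hq⟩
  unfold wt
  rw [h₁]
  split_ifs with h
  · refine ⟨1, le_rfl, rfl, ?_⟩
    have h₂ := sum_card_ch_lt (T := T) (insert q S ∪ T.ch q)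
    rw [sum_union, sum_insert hq] at h₂
    · have h₃ : #(T.ch q) ≤ ∑ x ∈ T.ch q, #(T.ch x) := by
        rw [card_eq_sum_ones]
        exact sum_le_sum fun x hx => card_pos.mpr (h.2.2 x hx)
      omega
    · rw [disjoint_insert_left]
      exact ⟨notMem_ch_self, hS.disjoint_ch hq⟩
  · refine ⟨0, Nat.zero_le _, rfl, ?_⟩
    have h₂ := sum_card_ch_lt (T := T) (insert q S)
    rw [sum_insert hq] at h₂
    omega

end ParentTree

namespace ParentTree

variable {V W : Type*} [DecidableEq V] [DecidableEq W]

/-- A host for embeddings of a rooted tree: `J x` holds the admissible images of non-leaves `x`,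
and `G x y` the admissible images of the children of `x` once `x` is sent to `y`. -/
structure Host (T : ParentTree W) (G : W → V → Finset V) (J : W → Finset V) (v : V)
    (δ σ : ℕ) : Prop where
  root_mem : v ∈ J T.root
  le_card : ∀ x y, y ∈ J x → δ ≤ #(G x y)
  irrefl : ∀ x y, y ∉ G x y
  codeg : ∀ x x' y z, y ≠ z → #(G x y ∩ G x' z) ≤ σ
  subset : ∀ w ∈ T.verts, w ≠ T.root → T.par w ≠ T.root → ∀ y ∈ J (T.par w), G (T.par w) y ⊆ J w

/-- The numerical conditions under which the embedding procedure runs. -/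
structure Bounds (T : ParentTree W) (C δ σ : ℕ) : Prop where
  ch_le : ∀ x ∈ T.verts, x ≠ T.root → #(T.ch x) ≤ C
  one : #T.verts + 2 + C + 3 * σ ≤ 3 * δ + #(T.ch T.root)
  one' : #T.verts + 4 + 3 * σ ≤ 3 * δ + #(T.ch T.root)
  root : (∀ w ∈ T.ch T.root, (T.ch w).Nonempty) ∨
    (#T.verts + C + 3 * σ ≤ 3 * δ + 1 ∧ #T.verts + 1 + 3 * σ ≤ 3 * δ)
  two : #T.verts + 2 + C + 6 * σ < 4 * δ
  two' : #T.verts + 4 + 6 * σ < 4 * δ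
  zero : #T.verts + 2 * C + 3 * σ < 3 * δ + 3 + #(T.ch T.root)
  zero' : #T.verts + C + 3 * σ < 3 * δ + #(T.ch T.root)
  large : #T.verts + 3 + 3 * σ ≤ 3 * δ

/-- A partial embedding of the non-leaves of a rooted tree, together with the Hall-type conditions
that allow it to be extended. -/
structure PartialEmb (T : ParentTree W) (G : W → V → Finset V) (J : W → Finset V) (v : V)
    (S : Finset W) (f : W → V) : Prop extends T.IsInitial S where
  map_root : f T.root = v
  nonleaf : ∀ x ∈ S, (T.ch x).Nonempty
  root_ch : ∀ w ∈ T.ch T.root, (T.ch w).Nonempty → w ∈ S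
  mem_J : ∀ x ∈ S, f x ∈ J x
  injOn : Set.InjOn f S
  edge : ∀ w ∈ S, w ≠ T.root → f w ∈ G (T.par w) (f (T.par w))
  pair : ∀ X ⊆ S, #X ≤ 2 → ∑ x ∈ X, T.wt S x ≤ #(X.biUnion (fun x => G x (f x)) \ S.image f)

variable {T : ParentTree W} {G : W → V → Finset V} {J : W → Finset V} {v : V} {δ σ C : ℕ}
  {S : Finset W} {f : W → V}

theorem PartialEmb.exists_extend (h : T.PartialEmb G J v S f) (hH : T.Host G J v δ σ)
    (hB : T.Bounds C δ σ) {q : W} (hq : q ∈ T.verts) (hqS : q ∉ S) (hqc : (T.ch q).Nonempty) :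
    ∃ q' ∈ T.verts, q' ∉ S ∧ ∃ f', T.PartialEmb G J v (insert q' S) f' := by
  classical
  obtain ⟨q, hq, hqS, hp, hqc⟩ : ∃ q' ∈ T.verts, q' ∉ S ∧ T.par q' ∈ S ∧ (T.ch q').Nonempty := by
    obtain ⟨q', h₁, h₂, h₃, h₄⟩ := h.exists_next hq hqS
    exact ⟨q', h₁, h₂, h₃, h₄.elim (fun e => e ▸ hqc) id⟩
  refine ⟨q, hq, hqS, ?_⟩
  have hqr : q ≠ T.root := fun e => hqS (e ▸ h.root_mem)
  set x₀ := T.par q with hx₀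
  have hqx : q ∈ T.ch x₀ := mem_ch.mpr ⟨hq, hqr, rfl⟩
  have hx₀r : x₀ ≠ T.root := fun e => hqS (h.root_ch q (e ▸ hqx) hqc)
  obtain ⟨κ, hκ, hwq, hroom⟩ := exists_wt_eq_add h.toIsInitial hqS
  set l := T.wt (insert q S) q with hl
  set A := ∑ x ∈ S, #(T.ch x) with hA
  set c := #(T.ch q) with hc
  have hc1 : 1 ≤ c := card_pos.mpr hqc
  have hcC : c ≤ C := hB.ch_le q hq hqr
  have hU : #(S.image f) = #S := card_image_of_injOn h.injOn
  have hsum := h.card_add_sum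
  have hsub : ∀ X ⊆ S, #S + ∑ x ∈ X, #(T.ch x \ S) ≤ 1 + A := fun X hX => by
    have := sum_le_sum_of_subset (f := fun x => #(T.ch x \ S)) hX
    omega
  have hsub' : ∀ X ⊆ S.erase x₀, #S + ∑ x ∈ X, #(T.ch x \ S) ≤ A := fun X hX => by
    have h₁ := sum_le_sum_of_subset (f := fun x => #(T.ch x \ S)) hX
    have h₂ := sum_erase_add (f := fun x => #(T.ch x \ S)) S hp
    have h₃ : 0 < #(T.ch x₀ \ S) := card_pos.mpr ⟨q, mem_sdiff.mpr ⟨hqx, hqS⟩⟩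
    omega
  have hA₁ : #S + #(T.ch T.root) ≤ A + 1 := by
    have h₁ := sum_erase_add (f := fun x => #(T.ch x)) S h.root_mem
    have h₂ : #(S.erase T.root) ≤ ∑ x ∈ S.erase T.root, #(T.ch x) := by
      rw [card_eq_sum_ones]
      exact sum_le_sum fun x hx => card_pos.mpr (h.nonleaf x (mem_of_mem_erase hx))
    rw [card_erase_of_mem h.root_mem] at h₂
    omega
  have hA₂ : ∀ y ∈ S, y ≠ T.root → #S + #(T.ch y \ S) + #(T.ch T.root) ≤ A + 2 := by
    intro y hy hyr
    have h₁ := sum_erase_add (f := fun x => #(T.ch x)) S h.root_mem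
    have hyS : y ∈ S.erase T.root := mem_erase.mpr ⟨hyr, hy⟩
    have h₃ := sum_erase_add (f := fun x => #(T.ch x)) (S.erase T.root) hyS
    have h₂ : #((S.erase T.root).erase y) ≤ ∑ x ∈ (S.erase T.root).erase y, #(T.ch x) := by
      rw [card_eq_sum_ones]
      exact sum_le_sum fun x hx =>
        card_pos.mpr (h.nonleaf x (mem_of_mem_erase (mem_of_mem_erase hx)))
    rw [card_erase_of_mem hyS, card_erase_of_mem h.root_mem] at h₂
    have h₄ : #(T.ch y \ S) ≤ #(T.ch y) := card_le_card sdiff_subset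
    omega
  have hroot : (∀ w ∈ T.ch T.root, (T.ch w).Nonempty) → #(T.ch T.root \ S) = 0 := by
    intro hall
    rw [card_eq_zero, sdiff_eq_empty_iff_subset]
    exact fun w hw => h.root_ch w hw (hall w hw)
  have hcκ : κ = 0 ∨ κ = 1 := by omega
  have hroom' : A + c + 1 ≤ #T.verts ∧ (κ = 1 → A + 2 * c + 1 ≤ #T.verts) := by
    rcases hcκ with rfl | rfl <;> constructor <;> intros <;> omega
  have hrootS : ∀ y ∈ S, y ≠ x₀ → #S + #(T.ch y \ S) ≤ A := fun y hy hne => by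
    simpa using hsub' {y} (by simpa using ⟨hne, hy⟩)
  have htwoS : ∀ y ∈ S, ∀ y' ∈ S, y ≠ y' → #S + (#(T.ch y \ S) + #(T.ch y' \ S)) ≤ 1 + A :=
    fun y hy y' hy' hne => by
      have := hsub {y, y'} (insert_subset hy (singleton_subset_iff.mpr hy'))
      rwa [sum_pair hne] at this
  have hwsum : ∀ X : Finset W, ∑ x ∈ X, T.wt S x ≤ ∑ x ∈ X, #(T.ch x \ S) + #X := fun X => by
    rw [card_eq_sum_ones, ← sum_add_distrib]
    exact sum_le_sum fun x _ => wt_le S x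
  obtain ⟨b1, b2, b3, b4, b5, b6, b7, b8, b9⟩ := hB
  have hGJ : ∀ z ∈ G x₀ (f x₀), z ∈ J q := fun z hz =>
    hH.subset q hq hqr hx₀r _ (h.mem_J x₀ hp) hz
  have hnotU : ∀ z, z ∉ S.image f → ∀ x ∈ S, z ≠ f x := fun z hz x hx e =>
    hz (e ▸ mem_image_of_mem f hx)
  obtain ⟨z, hz, ht, hl₁, hl₂, hl₃⟩ := exists_good_candidate S (fun x => G x (f x)) (T.wt S)
    (S.image f) x₀ hp (G q) l δ σ (fun x hx => hH.le_card _ _ (h.mem_J x hx))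
    (fun x hx y hy hne => hH.codeg _ _ _ _ (fun e => hne (h.injOn hx hy e)))
    (fun z hz => hH.le_card _ _ (hGJ z (mem_sdiff.mp hz).1)) (hH.irrefl q)
    (fun z hz x hx => hH.codeg _ _ _ _ (hnotU z (mem_sdiff.mp hz).2 x hx))
    (fun z z' hne => hH.codeg _ _ _ _ hne) h.pair
    (two_le_wt_par hq hqr hqS hqc hx₀r h.nonleaf)
    (by
      intro y hy
      rw [hU]
      by_cases hyr : y = T.root
      · have h₁ := hrootS y hy (fun e => hx₀r (e ▸ hyr))
        rw [hyr, wt_root]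
        rw [hyr] at h₁
        rcases b4 with b4 | b4
        · have := hroot b4
          rcases hcκ with rfl | rfl <;> omega
        · rcases hcκ with rfl | rfl <;> omega
      · have h₁ := hA₂ y hy hyr
        have h₂ := wt_le (T := T) S y
        rcases hcκ with rfl | rfl <;> omega)
    (by
      intro y hy y' hy' hne
      rw [hU]
      have h₁ := htwoS y hy y' hy' hne
      have h₂ := wt_le (T := T) S y
      have h₃ := wt_le (T := T) S y'
      rcases hcκ with rfl | rfl <;> omega)
    (by
      rw [hU]
      rcases hcκ with rfl | rfl <;> omega)
    (by
      intro X hX hX2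
      have h₁ := hsub' X hX
      have h₂ := hwsum X
      rw [hU]
      omega)
    (by
      intro X hX hX3 hX4
      have h₁ := hsub' X hX
      have h₂ := hwsum X
      rw [hU]
      omega)
  obtain ⟨hzG, hzU⟩ := mem_sdiff.mp hz
  have hupd : ∀ x ∈ S, Function.update f q z x = f x := fun x hx =>
    Function.update_of_ne (fun e => hqS (by rwa [e] at hx)) _ _
  have himg : (insert q S).image (Function.update f q z) = insert z (S.image f) := by
    rw [image_insert, Function.update_self]
    congr 1
    exact image_congr fun x hx => hupd x hx
  refine ⟨Function.update f q z, h.toIsInitial.insert_next hq hp, ?_, ?_, ?_, ?_, ?_, ?_, ?_⟩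
  · rw [hupd _ h.root_mem, h.map_root]
  · intro x hx
    rcases mem_insert.mp hx with rfl | hx
    exacts [hqc, h.nonleaf x hx]
  · exact fun w hw hwc => mem_insert_of_mem (h.root_ch w hw hwc)
  · intro x hx
    rcases mem_insert.mp hx with rfl | hx
    · rw [Function.update_self]; exact hGJ z hzG
    · rw [hupd x hx]; exact h.mem_J x hx
  · rw [coe_insert, Set.injOn_insert (by simpa using hqS), Function.update_self]
    refine ⟨fun x hx y hy e => h.injOn hx hy (by rwa [hupd x hx, hupd y hy] at e), ?_⟩
    rintro ⟨x, hx, e⟩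
    rw [hupd x hx] at e
    exact hnotU z hzU x hx e.symm
  · intro w hw hwr
    rcases mem_insert.mp hw with rfl | hw
    · rw [Function.update_self, ← hx₀, hupd _ hp]; exact hzG
    · rw [hupd w hw, hupd _ (h.par_mem w hw hwr)]; exact h.edge w hw hwr
  · rw [himg]
    refine pair_condition_extend S (fun x => G x (f x)) _ (T.wt S) _ _ x₀ hp q hqS z l
      (fun x hx => by simp only [hupd x hx]) ?_ h.pair ?_ (wt_insert_par hq hqr hqS) le_rfl ht ?_ ?_
      ?_
    · simp only [Function.update_self]; exact hH.irrefl q z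
    · intro x hx
      by_cases hxx : x = x₀
      · rw [hxx]
        exact (Nat.le_succ _).trans (wt_insert_par hq hqr hqS)
      · rw [wt_insert_of_ne hxx]
    · simpa only [Function.update_self] using hl₁
    · simpa only [Function.update_self] using hl₂
    · simpa only [Function.update_self] using hl₃

/-- Once all non-leaves are embedded, Hall's theorem places the leaves. -/
theorem PartialEmb.exists_full (h : T.PartialEmb G J v S f) (hH : T.Host G J v δ σ)
    (hK : #T.verts + 3 * σ ≤ 3 * δ) (hall : ∀ q ∈ T.verts, (T.ch q).Nonempty → q ∈ S) :
    ∃ g : W → V, Set.InjOn g T.verts ∧ g T.root = v ∧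
      ∀ w ∈ T.verts, w ≠ T.root → g w ∈ G (T.par w) (g (T.par w)) := by
  classical
  set U := S.image f with hU
  have hUc : #U = #S := card_image_of_injOn h.injOn
  let t : {w // w ∈ T.verts \ S} → Finset V := fun w => G (T.par w) (f (T.par w)) \ U
  have hne : ∀ w ∈ T.verts \ S, w ≠ T.root := fun w hw e =>
    (mem_sdiff.mp hw).2 (e ▸ h.root_mem)
  have hpar : ∀ w ∈ T.verts \ S, T.par w ∈ S := fun w hw =>
    hall _ (T.par_mem w (mem_sdiff.mp hw).1 (hne w hw))
      ⟨w, mem_ch.mpr ⟨(mem_sdiff.mp hw).1, hne w hw, rfl⟩⟩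
  have hHall : ∀ s : Finset {w // w ∈ T.verts \ S}, #s ≤ #(s.biUnion t) := by
    intro s
    set X := s.image (fun w : {w // w ∈ T.verts \ S} => T.par w) with hX
    have hXS : X ⊆ S := by
      intro x hx
      obtain ⟨w, _, rfl⟩ := mem_image.mp hx
      exact hpar w w.2
    have hbi : s.biUnion t = X.biUnion (fun x => G x (f x)) \ U := by
      ext z
      simp only [t, hX, mem_biUnion, mem_sdiff, mem_image]
      constructor
      · rintro ⟨w, hw, h₁, h₂⟩; exact ⟨⟨_, ⟨w, hw, rfl⟩, h₁⟩, h₂⟩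
      · rintro ⟨⟨_, ⟨w, hw, rfl⟩, h₁⟩, h₂⟩; exact ⟨w, hw, h₁, h₂⟩
    have hs : #s ≤ ∑ x ∈ X, #(T.ch x \ S) := by
      rw [card_eq_sum_card_image (fun w : {w // w ∈ T.verts \ S} => T.par w) s]
      refine sum_le_sum fun x _ => ?_
      refine card_le_card_of_injOn (fun w => (w : W)) ?_ (fun _ _ _ _ e => Subtype.ext e)
      intro w hw
      have hw' := (mem_filter.mp hw).2
      have h₁ := mem_sdiff.mp w.2
      exact mem_coe.mpr (mem_sdiff.mpr ⟨mem_ch.mpr ⟨h₁.1, hne w w.2, hw'⟩, h₁.2⟩)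
    rw [hbi]
    by_cases hX2 : #X ≤ 2
    · have h₁ : _ ≤ #(_ \ U) := h.pair X hXS hX2
      have h₂ : ∑ x ∈ X, #(T.ch x \ S) ≤ ∑ x ∈ X, T.wt S x :=
        sum_le_sum fun x _ => Nat.le_add_right _ _
      omega
    · obtain ⟨a, b, c, ha, hb, hc, hab, hac, hbc⟩ := two_lt_card_iff.mp (by omega : 2 < #X)
      have hcd : ∀ x ∈ X, ∀ y ∈ X, x ≠ y → #(G x (f x) ∩ G y (f y)) ≤ σ := fun x hx y hy hxy =>
        hH.codeg _ _ _ _ (fun e => hxy (h.injOn (hXS hx) (hXS hy) e))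
      have hdl : ∀ x ∈ X, δ ≤ #(G x (f x)) := fun x hx => hH.le_card _ _ (h.mem_J x (hXS hx))
      have h₁ := three_mul_le_card_union (hdl a ha) (hdl b hb) (hdl c hc)
        (hcd a ha b hb hab) (hcd a ha c hc hac) (hcd b hb c hc hbc)
      have h₂ : G a (f a) ∪ G b (f b) ∪ G c (f c) ⊆ X.biUnion (fun x => G x (f x)) :=
        union_subset (union_subset (subset_biUnion_of_mem (fun x => G x (f x)) ha)
          (subset_biUnion_of_mem (fun x => G x (f x)) hb))
          (subset_biUnion_of_mem (fun x => G x (f x)) hc)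
      have h₃ := card_le_card h₂
      have h₄ := card_le_card_sdiff_add (X.biUnion (fun x => G x (f x))) U
      have h₅ := sum_le_sum_of_subset (f := fun x => #(T.ch x \ S)) hXS
      have h₆ := h.card_add_sum
      have h₇ := sum_card_ch_lt (T := T) S
      omega
  obtain ⟨g, hg, hgt⟩ := (all_card_le_biUnion_card_iff_exists_injective t).mp hHall
  let F : W → V := fun w => if hw : w ∈ T.verts \ S then g ⟨w, hw⟩ else f w
  have hFS : ∀ w ∈ S, F w = f w := fun w hw => dif_neg (fun h' => (mem_sdiff.mp h').2 hw)
  have hFt : ∀ w (hw : w ∈ T.verts \ S), F w = g ⟨w, hw⟩ := fun w hw => dif_pos hw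
  have hgU : ∀ w (hw : w ∈ T.verts \ S), g ⟨w, hw⟩ ∉ U := fun w hw =>
    (mem_sdiff.mp (hgt ⟨w, hw⟩)).2
  refine ⟨F, ?_, by rw [hFS _ h.root_mem, h.map_root], ?_⟩
  · intro x hx y hy e
    by_cases hxS : x ∈ S <;> by_cases hyS : y ∈ S
    · rw [hFS x hxS, hFS y hyS] at e
      exact h.injOn hxS hyS e
    · have hy' : y ∈ T.verts \ S := mem_sdiff.mpr ⟨hy, hyS⟩
      rw [hFS x hxS, hFt y hy'] at e
      exact absurd (e ▸ mem_image_of_mem f hxS) (hgU y hy')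
    · have hx' : x ∈ T.verts \ S := mem_sdiff.mpr ⟨hx, hxS⟩
      rw [hFS y hyS, hFt x hx'] at e
      exact absurd (e ▸ mem_image_of_mem f hyS) (hgU x hx')
    · have hx' : x ∈ T.verts \ S := mem_sdiff.mpr ⟨hx, hxS⟩
      have hy' : y ∈ T.verts \ S := mem_sdiff.mpr ⟨hy, hyS⟩
      rw [hFt x hx', hFt y hy'] at e
      exact congrArg Subtype.val (hg e)
  · intro w hw hwr
    by_cases hwS : w ∈ S
    · rw [hFS w hwS, hFS _ (h.par_mem w hwS hwr)]
      exact h.edge w hwS hwr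
    · have hw' : w ∈ T.verts \ S := mem_sdiff.mpr ⟨hw, hwS⟩
      rw [hFt w hw', hFS _ (hpar w hw')]
      exact (mem_sdiff.mp (hgt ⟨w, hw'⟩)).1

end ParentTree

theorem exists_injOn_of_card_le {V W : Type*} [Nonempty V] {A : Finset W} {B : Finset V}
    (h : #A ≤ #B) : ∃ f : W → V, Set.InjOn f A ∧ ∀ a ∈ A, f a ∈ B := by
  classical
  obtain ⟨e⟩ := Function.Embedding.nonempty_of_card_le (α := A) (β := B) (by simpa using h)
  refine ⟨fun w => if hw : w ∈ A then e ⟨w, hw⟩ else Classical.arbitrary V, ?_, ?_⟩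
  · intro x hx y hy hxy
    have hx' : x ∈ A := hx
    have hy' : y ∈ A := hy
    simp only [hx', hy', dif_pos] at hxy
    exact congrArg Subtype.val (e.injective (Subtype.ext hxy))
  · intro a ha
    simp only [ha, dif_pos]
    exact (e ⟨a, ha⟩).2

namespace ParentTree

variable {V W : Type*} [DecidableEq V] [DecidableEq W]
variable {T : ParentTree W} {G : W → V → Finset V} {J : W → Finset V} {v : V} {δ σ C : ℕ}

/-- The starting configuration: the root and its non-leaf children. -/
theorem Host.exists_partialEmb (hH : T.Host G J v δ σ)
    (hC : ∀ x ∈ T.verts, x ≠ T.root → #(T.ch x) ≤ C)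
    (hd : (T.ch T.root).Nonempty) (hdeg : #(T.ch T.root) ≤ #(G T.root v)) (N : Finset V)
    (hN : N ⊆ G T.root v) (hNc : #((T.ch T.root).filter (fun w => (T.ch w).Nonempty)) ≤ #N)
    (hNJ : ∀ w ∈ T.ch T.root, N ⊆ J w) (h₁ : C + 2 + σ ≤ δ) (h₂ : 2 * C + 3 + 3 * σ ≤ 2 * δ) :
    ∃ S f, T.PartialEmb G J v S f := by
  classical
  set L := (T.ch T.root).filter (fun w => (T.ch w).Nonempty) with hL
  have : Nonempty V := ⟨v⟩
  obtain ⟨e, he, heN⟩ := exists_injOn_of_card_le hNc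
  have hrL : T.root ∉ L := fun h => notMem_ch_self (mem_filter.mp h).1
  set f := Function.update e T.root v with hf
  have hfr : f T.root = v := Function.update_self _ _ _
  have hfL : ∀ w ∈ L, f w = e w := fun w hw =>
    Function.update_of_ne (fun h => hrL (by rwa [h] at hw)) _ _
  have hfG : ∀ w ∈ L, f w ∈ G T.root v := fun w hw => hfL w hw ▸ hN (heN w hw)
  have hfv : ∀ w ∈ L, f w ≠ v := fun w hw h => hH.irrefl T.root v (h ▸ hfG w hw)
  have hLch : ∀ w ∈ L, w ∈ T.verts ∧ w ≠ T.root ∧ T.par w = T.root := fun w hw =>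
    mem_ch.mp (mem_filter.mp hw).1
  have hinj : Set.InjOn f (insert T.root L : Finset W) := by
    rw [coe_insert, Set.injOn_insert (by simpa using hrL)]
    refine ⟨fun x hx y hy h => he hx hy (by rwa [hfL x hx, hfL y hy] at h), ?_⟩
    rintro ⟨x, hx, h⟩
    exact hfv x hx (h.trans hfr)
  have hI : T.IsInitial (insert T.root L) := by
    refine ⟨insert_subset T.root_mem fun w hw => (hLch w hw).1, mem_insert_self _ _, ?_⟩
    intro w hw hwr
    rw [(hLch w ((mem_insert.mp hw).resolve_left hwr)).2.2]
    exact mem_insert_self _ _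
  have hJ : ∀ x ∈ insert T.root L, f x ∈ J x := by
    intro x hx
    rcases mem_insert.mp hx with rfl | hx
    · rw [hfr]; exact hH.root_mem
    · rw [hfL x hx]; exact hNJ x (mem_filter.mp hx).1 (heN x hx)
  set U := (insert T.root L).image f with hU
  have hUsub : ∀ z ∈ U, z = v ∨ z ∈ G T.root v := by
    intro z hz
    obtain ⟨x, hx, rfl⟩ := mem_image.mp hz
    rcases mem_insert.mp hx with rfl | hx
    exacts [Or.inl hfr, Or.inr (hfG x hx)]
  have hwt : ∀ x ∈ L, T.wt (insert T.root L) x ≤ C + 1 := fun x hx => by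
    have a₁ := wt_le (T := T) (insert T.root L) x
    have a₂ := hC x (hLch x hx).1 (hLch x hx).2.1
    have a₃ : #(T.ch x \ insert T.root L) ≤ #(T.ch x) := card_le_card sdiff_subset
    omega
  have hroot : T.wt (insert T.root L) T.root ≤ #(G T.root v \ U) := by
    have hLsub : L ⊆ T.ch T.root := filter_subset _ _
    have a₁ : T.ch T.root \ insert T.root L = T.ch T.root \ L := by
      ext w
      simp only [mem_sdiff, mem_insert, not_or]
      exact ⟨fun h => ⟨h.1, h.2.2⟩, fun h => ⟨h.1, fun e => notMem_ch_self (e ▸ h.1), h.2⟩⟩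
    have a₂ := card_sdiff_add_card_eq_card hLsub
    have a₃ : G T.root v \ L.image f ⊆ G T.root v \ U := by
      intro z hz
      rw [mem_sdiff] at hz ⊢
      refine ⟨hz.1, ?_⟩
      rw [hU, image_insert, mem_insert]
      rintro (h | h)
      · rw [hfr] at h
        exact hH.irrefl T.root v (h ▸ hz.1)
      · exact hz.2 h
    have a₄ := card_le_card a₃
    have a₅ := card_le_card_sdiff_add (G T.root v) (L.image f)
    have a₆ : #(L.image f) ≤ #L := card_image_le
    rw [wt_root, a₁]
    omega
  have hfree : ∀ x ∈ L, δ ≤ #((G x (f x) \ U) \ G T.root v) + σ + 1 := by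
    intro x hx
    have a₁ := hH.le_card x (f x) (hJ x (mem_insert_of_mem hx))
    have a₂ := hH.codeg x T.root (f x) v (hfv x hx)
    have a₃ : G x (f x) ⊆
        ((G x (f x) \ U) \ G T.root v) ∪ (G x (f x) ∩ G T.root v) ∪ {v} := by
      intro z hz
      have := hUsub z
      simp only [mem_union, mem_sdiff, mem_inter, mem_singleton]
      tauto
    have a₄ := card_le_card a₃
    have a₅ := card_union_le (((G x (f x) \ U) \ G T.root v) ∪ (G x (f x) ∩ G T.root v)) {v}
    have a₆ := card_union_le ((G x (f x) \ U) \ G T.root v) (G x (f x) ∩ G T.root v)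
    rw [card_singleton] at a₅
    omega
  have hone : ∀ x ∈ L, T.wt (insert T.root L) x ≤ #((G x (f x) \ U) \ G T.root v) := fun x hx => by
    have := hfree x hx
    have := hwt x hx
    omega
  have hrx : ∀ x ∈ L, T.wt (insert T.root L) T.root + T.wt (insert T.root L) x ≤
      #((G T.root (f T.root) ∪ G x (f x)) \ U) := by
    intro x hx
    have a₁ : (G T.root v \ U) ∪ ((G x (f x) \ U) \ G T.root v) ⊆
        (G T.root (f T.root) ∪ G x (f x)) \ U := by
      rw [hfr]
      intro z
      simp only [mem_union, mem_sdiff]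
      tauto
    have a₂ := card_le_card a₁
    rw [card_union_of_disjoint] at a₂
    · have := hone x hx
      omega
    · rw [disjoint_left]
      intro z
      simp only [mem_sdiff]
      tauto
  have hxy : ∀ x ∈ L, ∀ y ∈ L, x ≠ y →
      T.wt (insert T.root L) x + T.wt (insert T.root L) y ≤ #((G x (f x) ∪ G y (f y)) \ U) := by
    intro x hx y hy hne
    have a₁ := card_union_add_card_inter ((G x (f x) \ U) \ G T.root v)
      ((G y (f y) \ U) \ G T.root v)
    have hfne : f x ≠ f y := fun h =>
      hne (hinj (mem_insert_of_mem hx) (mem_insert_of_mem hy) h)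
    have b₁ := hH.le_card x (f x) (hJ x (mem_insert_of_mem hx))
    have b₂ := hH.le_card y (f y) (hJ y (mem_insert_of_mem hy))
    have b₃ := card_union_add_card_inter (G x (f x)) (G y (f y))
    have b₄ := hH.codeg x y (f x) (f y) hfne
    have b₅ := hH.codeg x T.root (f x) v (hfv x hx)
    have b₆ := hH.codeg y T.root (f y) v (hfv y hy)
    have b₇ : G x (f x) ∪ G y (f y) ⊆ ((G x (f x) ∪ G y (f y)) \ U) ∪
        ((G x (f x) ∩ G T.root v) ∪ (G y (f y) ∩ G T.root v)) ∪ {v} := by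
      intro z hz
      have := hUsub z
      simp only [mem_union, mem_sdiff, mem_inter, mem_singleton] at hz ⊢
      tauto
    have b₈ := card_le_card b₇
    have b₉ := card_union_le (((G x (f x) ∪ G y (f y)) \ U) ∪
        ((G x (f x) ∩ G T.root v) ∪ (G y (f y) ∩ G T.root v))) {v}
    have c₁ := card_union_le ((G x (f x) ∪ G y (f y)) \ U)
        ((G x (f x) ∩ G T.root v) ∪ (G y (f y) ∩ G T.root v))
    have c₂ := card_union_le (G x (f x) ∩ G T.root v) (G y (f y) ∩ G T.root v)
    rw [card_singleton] at b₉
    have c₃ := hwt x hx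
    have c₄ := hwt y hy
    omega
  refine ⟨insert T.root L, f, hI, hfr, ?_, ?_, hJ, hinj, ?_, ?_⟩
  · intro x hx
    rcases mem_insert.mp hx with rfl | hx
    exacts [hd, (mem_filter.mp hx).2]
  · exact fun w hw hwc => mem_insert_of_mem (mem_filter.mpr ⟨hw, hwc⟩)
  · intro w hw hwr
    have hwL := (mem_insert.mp hw).resolve_left hwr
    rw [(hLch w hwL).2.2, hfr]
    exact hfG w hwL
  · intro X hX hX2
    have hcases : #X = 0 ∨ #X = 1 ∨ #X = 2 := by omega
    rcases hcases with h | h | h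
    · obtain rfl := card_eq_zero.mp h
      simp
    · obtain ⟨x, rfl⟩ := card_eq_one.mp h
      rw [sum_singleton, singleton_biUnion]
      rcases mem_insert.mp (hX (mem_singleton_self x)) with rfl | hx
      · rw [hfr]; exact hroot
      · exact (hone x hx).trans (card_le_card sdiff_subset)
    · obtain ⟨x, y, hne, rfl⟩ := card_eq_two.mp h
      rw [sum_pair hne, biUnion_insert, singleton_biUnion]
      rcases mem_insert.mp (hX (mem_insert_self x {y})) with rfl | hx <;>
        rcases mem_insert.mp (hX (mem_insert_of_mem (mem_singleton_self y))) with rfl | hy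
      · exact absurd rfl hne
      · exact hrx y hy
      · rw [add_comm, union_comm]; exact hrx x hx
      · exact hxy x hx y hy hne

theorem Host.exists_embedding (hH : T.Host G J v δ σ) (hB : T.Bounds C δ σ)
    (hd : (T.ch T.root).Nonempty) (hdeg : #(T.ch T.root) ≤ #(G T.root v)) (N : Finset V)
    (hN : N ⊆ G T.root v) (hNc : #((T.ch T.root).filter (fun w => (T.ch w).Nonempty)) ≤ #N)
    (hNJ : ∀ w ∈ T.ch T.root, N ⊆ J w) (h₁ : C + 2 + σ ≤ δ) (h₂ : 2 * C + 3 + 3 * σ ≤ 2 * δ) :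
    ∃ g : W → V, Set.InjOn g T.verts ∧ g T.root = v ∧
      ∀ w ∈ T.verts, w ≠ T.root → g w ∈ G (T.par w) (g (T.par w)) := by
  classical
  obtain ⟨S₀, f₀, h₀⟩ := hH.exists_partialEmb hB.ch_le hd hdeg N hN hNc hNJ h₁ h₂
  obtain ⟨S, hS, hmax⟩ := exists_max_image
    (T.verts.powerset.filter (fun S => ∃ f, T.PartialEmb G J v S f)) card
    ⟨S₀, by simpa using ⟨h₀.subset, f₀, h₀⟩⟩
  obtain ⟨_, f, hf⟩ := mem_filter.mp hS
  refine hf.exists_full hH (by have := hB.large; omega) fun q hq hqc => ?_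
  by_contra hqS
  obtain ⟨q', hq', hqS', f', hf'⟩ := hf.exists_extend hH hB hq hqS hqc
  have := hmax (insert q' S) (mem_filter.mpr ⟨mem_powerset.mpr hf'.subset, f', hf'⟩)
  rw [card_insert_of_notMem hqS'] at this
  omega

end ParentTree

section RelNbr

variable {V : Type*}

/-- Neighbours in a bipartite graph with parts `P true` and `P false`, whose edges are the pairs
`a ∈ P true`, `b ∈ P false` with `R a b`. -/
def relNbr (R : V → V → Bool) (P : Bool → Finset V) (s : Bool) (a : V) : Finset V :=
  (P !s).filter (fun b => if s then R a b else R b a)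

variable {R : V → V → Bool} {P Q : Bool → Finset V}

theorem relNbr_subset (s : Bool) (a : V) : relNbr R P s a ⊆ P !s := filter_subset _ _

theorem relNbr_mono (h : ∀ s, P s ⊆ Q s) (s : Bool) (a : V) : relNbr R P s a ⊆ relNbr R Q s a :=
  filter_subset_filter _ (h _)

theorem mem_relNbr_symm {s : Bool} {a b : V} (ha : a ∈ P s) (hb : b ∈ relNbr R P s a) :
    a ∈ relNbr R P (!s) b := by
  cases s <;> simp_all [relNbr]

/-- The relation `R` is irreflexive and distinct vertices have at most `σ` common neighbours. -/
structure Sparse [Fintype V] [DecidableEq V] (R : V → V → Bool) (σ : ℕ) : Prop where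
  irrefl : ∀ s P a, a ∉ relNbr R P s a
  codeg_univ : ∀ s s' a b, a ≠ b →
    #(relNbr R (fun _ => univ) s a ∩ relNbr R (fun _ => univ) s' b) ≤ σ

theorem Sparse.codeg [Fintype V] [DecidableEq V] {σ : ℕ} (h : Sparse R σ) (s s' : Bool) {a b : V}
    (hab : a ≠ b) : #(relNbr R P s a ∩ relNbr R Q s' b) ≤ σ :=
  (card_le_card (inter_subset_inter (relNbr_mono (fun _ => subset_univ _) _ _)
    (relNbr_mono (fun _ => subset_univ _) _ _))).trans (h.codeg_univ s s' a b hab)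

end RelNbr

namespace ParentTree

variable {V W : Type*} [DecidableEq V] [DecidableEq W] [Fintype V]
variable {T : ParentTree W} {R : V → V → Bool} {P : Bool → Finset V} {v : V} {d m σ : ℕ}
  {side : W → Bool}

/-- The two classes of a bipartition of a rooted tree, the root being on the side `true`. -/
structure IsSide (T : ParentTree W) (side : W → Bool) : Prop where
  root : side T.root = true
  par : ∀ w ∈ T.verts, w ≠ T.root → side w = !side (T.par w)

/-- A partial embedding in which every embedded vertex of side `false` comes with all its
children. -/
structure LookEmb (T : ParentTree W) (side : W → Bool) (R : V → V → Bool) (P : Bool → Finset V)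
    (v : V) (S : Finset W) (f : W → V) : Prop extends T.IsInitial S where
  map_root : f T.root = v
  ch_subset : ∀ w ∈ S, side w = false → T.ch w ⊆ S
  mem_part : ∀ w ∈ S, f w ∈ P (side w)
  injOn : Set.InjOn f S
  edge : ∀ w ∈ S, w ≠ T.root → f w ∈ relNbr R P (side (T.par w)) (f (T.par w))

variable {S : Finset W} {f : W → V}

/-- Among more than enough vertices adjacent to `x`, one has many neighbours outside `U`. -/
theorem _root_.Sparse.exists_free (hR : Sparse R σ) {x : V} {O U : Finset V} {c : ℕ}
    (hO : O ⊆ relNbr R P true x) (hx : x ∈ U)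
    (hdeg : ∀ y ∈ P false, m + 1 ≤ #(relNbr R P false y)) (hσ : 1 ≤ σ) (hcm : c ≤ m)
    (hUc : #U + 2 * c ≤ 1 + 2 * m) (hOc : 2 * σ ≤ #O) :
    ∃ w ∈ O, c ≤ #(relNbr R P false w \ U) := by
  by_contra! hcon
  have hOP : ∀ w ∈ O, w ∈ P false := fun w hw => relNbr_subset true x (hO hw)
  obtain ⟨e, rfl⟩ := Nat.exists_eq_add_of_le hcm
  have h₁ : ∀ w ∈ O, e + 1 ≤ #((U.erase x).filter (fun t => t ∈ relNbr R P false w)) := by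
    intro w hw
    have a₁ := hcon w hw
    have a₂ := hdeg w (hOP w hw)
    have a₃ : relNbr R P false w ⊆ (relNbr R P false w \ U) ∪
        (U.erase x).filter (fun t => t ∈ relNbr R P false w) ∪ {x} := by
      intro t ht
      simp only [mem_union, mem_sdiff, mem_filter, mem_erase, mem_singleton]
      tauto
    have a₄ := card_le_card a₃
    have a₅ := card_union_le ((relNbr R P false w \ U) ∪
        (U.erase x).filter (fun t => t ∈ relNbr R P false w)) {x}
    have a₆ := card_union_le (relNbr R P false w \ U)
        ((U.erase x).filter (fun t => t ∈ relNbr R P false w))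
    rw [card_singleton] at a₅
    omega
  have h₂ : ∀ t ∈ U.erase x, #(O.filter (fun w => t ∈ relNbr R P false w)) ≤ σ := by
    intro t ht
    refine (card_le_card ?_).trans (hR.codeg (P := P) (Q := P) true true (mem_erase.mp ht).1)
    intro w hw
    obtain ⟨hw, htw⟩ := mem_filter.mp hw
    exact mem_inter.mpr ⟨mem_relNbr_symm (s := false) (hOP w hw) htw, hO hw⟩
  have h₃ := sum_card_bipartiteAbove_eq_sum_card_bipartiteBelow (s := O) (t := U.erase x)
    (fun w t => t ∈ relNbr R P false w)
  have h₄ : #O * (e + 1) ≤ ∑ w ∈ O, #(bipartiteAbove (fun w t => t ∈ relNbr R P false w)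
      (U.erase x) w) := by
    rw [← smul_eq_mul]
    exact card_nsmul_le_sum _ _ _ h₁
  have h₅ : ∑ t ∈ U.erase x, #(bipartiteBelow (fun w t => t ∈ relNbr R P false w) O t) ≤
      #(U.erase x) * σ := by
    rw [← smul_eq_mul]
    exact sum_le_card_nsmul _ _ _ h₂
  rw [card_erase_of_mem hx] at h₅
  have h₆ : 2 * σ * (e + 1) ≤ #O * (e + 1) := Nat.mul_le_mul_right _ hOc
  have h₇ : (#U - 1) * σ ≤ 2 * e * σ := Nat.mul_le_mul_right _ (by omega)
  nlinarith

/-- Bounds on the part of the tree that is embedded before `y` and its children. -/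
theorem IsInitial.card_le_of_next (hS : T.IsInitial S)
    (hnl : ∀ w ∈ T.ch T.root, (T.ch w).Nonempty) (hm : #T.verts ≤ 1 + #(T.ch T.root) + m)
    {y : W} (hy : y ∈ T.verts) (hyS : y ∉ S) :
    #(T.ch y) ≤ m ∧ #S + 2 * #(T.ch y) ≤ 1 + 2 * m := by
  have hyr : y ≠ T.root := fun e => hyS (e ▸ hS.root_mem)
  have h₁ : #S + 1 + #(T.ch y) ≤ #T.verts := by
    have h := hS.disjoint_ch hyS
    rw [← card_insert_of_notMem hyS, ← card_union_of_disjoint]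
    · exact card_le_card (union_subset (insert_subset hy hS.subset) (filter_subset _ _))
    · exact disjoint_insert_left.mpr ⟨notMem_ch_self, h⟩
  have h₂ : #(T.ch T.root) + #(T.ch y) ≤ m + 1 := by
    have a₁ := sum_card_ch_lt (T := T) (insert T.root (insert y (T.ch T.root)))
    have a₂ : T.root ∉ insert y (T.ch T.root) := by
      rw [mem_insert]
      rintro (h | h)
      exacts [hyr h.symm, notMem_ch_self h]
    rw [sum_insert a₂] at a₁
    have a₃ : ∀ X ⊆ T.ch T.root, #X ≤ ∑ x ∈ X, #(T.ch x) := fun X hX => by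
      rw [card_eq_sum_ones]
      exact sum_le_sum fun x hx => card_pos.mpr (hnl x (hX hx))
    by_cases hyc : y ∈ T.ch T.root
    · rw [insert_eq_of_mem hyc, ← sum_erase_add _ _ hyc] at a₁
      have a₄ := a₃ _ (erase_subset y (T.ch T.root))
      rw [card_erase_of_mem hyc] at a₄
      omega
    · rw [sum_insert hyc] at a₁
      have a₄ := a₃ _ subset_rfl
      omega
  constructor
  · by_cases hyc : y ∈ T.ch T.root
    · have := card_pos.mpr ⟨y, hyc⟩
      omega
    · by_contra! hlt
      have : T.ch T.root = ∅ := card_eq_zero.mp (by omega)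
      rw [this] at hm
      simp at hm
      omega
  · omega

end ParentTree

namespace ParentTree

variable {V W : Type*} [DecidableEq V] [DecidableEq W] [Fintype V]
variable {T : ParentTree W} {R : V → V → Bool} {P : Bool → Finset V} {v : V} {d m σ : ℕ}
  {side : W → Bool} {S : Finset W} {f : W → V}

/-- The host conditions for the embedding procedure with lookahead. -/
structure LookHost (T : ParentTree W) (R : V → V → Bool) (P : Bool → Finset V) (v : V)
    (d m σ : ℕ) : Prop where
  nonleaf : ∀ w ∈ T.ch T.root, (T.ch w).Nonempty
  card_le : #T.verts ≤ 1 + #(T.ch T.root) + m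
  root_deg : d + m ≤ #(relNbr R P true v)
  deg_true : ∀ y ∈ P true, d ≤ #(relNbr R P true y)
  deg_false : ∀ y ∈ P false, m + 1 ≤ #(relNbr R P false y)
  le : m + 3 * σ ≤ d + 1
  pos : 1 ≤ σ

theorem LookEmb.two_mul_le_card_sdiff (h : T.LookEmb side R P v S f) (hR : Sparse R σ)
    (hs : T.IsSide side) (hH : T.LookHost R P v d m σ) {y : W} (hy : y ∈ T.verts) (hyS : y ∉ S)
    (hp : T.par y ∈ S) (hsp : side (T.par y) = true) :
    2 * σ ≤ #(relNbr R P true (f (T.par y)) \ S.image f) := by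
  obtain ⟨hcm, hSc⟩ := h.card_le_of_next hH.nonleaf hH.card_le hy hyS
  have hyr : y ≠ T.root := fun e => hyS (e ▸ h.root_mem)
  have hH4 := hH.le
  have hH5 := hH.pos
  by_cases hpr : T.par y = T.root
  · rw [hpr, h.map_root]
    have h₁ : relNbr R P true v ⊆ (relNbr R P true v \ S.image f) ∪ (S.image f).erase v := by
      intro t ht
      simp only [mem_union, mem_sdiff, mem_erase]
      by_cases htS : t ∈ S.image f
      · exact Or.inr ⟨fun e => hR.irrefl true P v (e ▸ ht), htS⟩
      · exact Or.inl ⟨ht, htS⟩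
    have h₂ := (card_le_card h₁).trans (card_union_le _ _)
    have h₃ : v ∈ S.image f := h.map_root ▸ mem_image_of_mem f h.root_mem
    have h₄ : #(S.image f) ≤ #S := card_image_le
    rw [card_erase_of_mem h₃] at h₂
    have := hH.root_deg
    omega
  · set p := T.par y with hpdef
    have hpv : p ∈ T.verts := h.subset hp
    set Q := S \ insert T.root (insert p (T.ch T.root)) with hQ
    have hQc : #Q + (#(T.ch y) + 2) ≤ m := by
      have hnc : ∀ x, x ∈ T.ch T.root → side x = false := fun x hx => by
        obtain ⟨a₁, a₂, a₃⟩ := mem_ch.mp hx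
        rw [hs.par x a₁ a₂, a₃, hs.root]
        rfl
      have hpc : p ∉ T.ch T.root := fun h' => by
        have := hnc p h'
        rw [hsp] at this
        exact absurd this (by simp)
      have hychr : y ∉ T.ch T.root := fun h' => hpr (mem_ch.mp h').2.2
      have hpy : p ∉ insert y (T.ch y) := by
        rw [mem_insert]
        rintro (e | e)
        · exact hyS (e ▸ hp)
        · exact disjoint_left.mp (h.disjoint_ch hyS) hp e
      have a₁ : #(insert p (insert y (T.ch y))) = #(T.ch y) + 2 := by
        rw [card_insert_of_notMem hpy, card_insert_of_notMem notMem_ch_self]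
      have a₂ : #(insert T.root (T.ch T.root)) = #(T.ch T.root) + 1 :=
        card_insert_of_notMem notMem_ch_self
      have a₃ : Disjoint Q (insert p (insert y (T.ch y))) := by
        rw [disjoint_left]
        intro t ht
        have ht' := mem_sdiff.mp ht
        have := disjoint_left.mp (h.disjoint_ch hyS) ht'.1
        simp only [mem_insert] at ht' ⊢
        rintro (rfl | rfl | e)
        exacts [ht'.2 (Or.inr (Or.inl rfl)), hyS ht'.1, this e]
      have a₄ : Disjoint (Q ∪ insert p (insert y (T.ch y))) (insert T.root (T.ch T.root)) := by
        rw [disjoint_left]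
        intro t ht
        simp only [hQ, mem_union, mem_sdiff, mem_insert] at ht ⊢
        rcases ht with ⟨_, ht⟩ | rfl | rfl | ht
        · tauto
        · exact fun e => e.elim hpr hpc
        · exact fun e => e.elim hyr hychr
        · obtain ⟨_, b₂, b₃⟩ := mem_ch.mp ht
          rintro (e | e)
          · exact b₂ e
          · exact hyr (b₃.symm.trans (mem_ch.mp e).2.2)
      have a₅ : (Q ∪ insert p (insert y (T.ch y))) ∪ insert T.root (T.ch T.root) ⊆ T.verts := by
        refine union_subset (union_subset (sdiff_subset.trans h.subset) ?_) ?_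
        · exact insert_subset hpv (insert_subset hy (filter_subset _ _))
        · exact insert_subset T.root_mem (filter_subset _ _)
      have a₆ := card_le_card a₅
      rw [card_union_of_disjoint a₄, card_union_of_disjoint a₃, a₁, a₂] at a₆
      have := hH.card_le
      omega
    have hfp : f p ≠ v := fun e => hpr (h.injOn hp h.root_mem (e.trans h.map_root.symm))
    have h₁ : relNbr R P true (f p) ⊆ (relNbr R P true (f p) \ S.image f) ∪
        (relNbr R P true (f p) ∩ relNbr R P true v) ∪ insert v (Q.image f) := by
      intro t ht
      by_cases htS : t ∈ S.image f
      · obtain ⟨x, hx, rfl⟩ := mem_image.mp htS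
        by_cases hxr : x = T.root
        · rw [hxr, h.map_root]
          exact mem_union_right _ (mem_insert_self _ _)
        by_cases hxc : x ∈ T.ch T.root
        · have := h.edge x hx hxr
          rw [(mem_ch.mp hxc).2.2, hs.root, h.map_root] at this
          exact mem_union_left _ (mem_union_right _ (mem_inter.mpr ⟨ht, this⟩))
        · refine mem_union_right _ (mem_insert_of_mem (mem_image_of_mem f ?_))
          rw [hQ, mem_sdiff, mem_insert, mem_insert]
          refine ⟨hx, ?_⟩
          rintro (e | e | e)
          exacts [hxr e, hR.irrefl true P (f p) (by rwa [e] at ht), hxc e]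
      · exact mem_union_left _ (mem_union_left _ (mem_sdiff.mpr ⟨ht, htS⟩))
    have h₂ := (card_le_card h₁).trans (card_union_le _ _)
    have h₃ := card_union_le (relNbr R P true (f p) \ S.image f)
      (relNbr R P true (f p) ∩ relNbr R P true v)
    have h₄ := hR.codeg (P := P) (Q := P) true true hfp
    have h₅ := card_insert_le v (Q.image f)
    have h₆ : #(Q.image f) ≤ #Q := card_image_le
    have h₇ := hH.deg_true (f p) (hsp ▸ h.mem_part p hp)
    omega

theorem LookEmb.exists_extend (h : T.LookEmb side R P v S f) (hR : Sparse R σ)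
    (hs : T.IsSide side) (hH : T.LookHost R P v d m σ) {q : W} (hq : q ∈ T.verts) (hqS : q ∉ S) :
    ∃ y ∉ S, ∃ S' f', insert y S ⊆ S' ∧ T.LookEmb side R P v S' f' := by
  classical
  obtain ⟨y, hy, hyS, hp, -⟩ := h.exists_next hq hqS
  refine ⟨y, hyS, ?_⟩
  have hyr : y ≠ T.root := fun e => hyS (e ▸ h.root_mem)
  set p := T.par y with hpdef
  have hsp : side p = true := by
    by_contra hsp
    exact hyS (h.ch_subset p hp (by simpa using hsp) (mem_ch.mpr ⟨hy, hyr, rfl⟩))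
  have hsy : side y = false := by rw [hs.par y hy hyr, ← hpdef, hsp]; rfl
  obtain ⟨hcm, hSc⟩ := h.card_le_of_next hH.nonleaf hH.card_le hy hyS
  have hO := h.two_mul_le_card_sdiff hR hs hH hy hyS hp hsp
  have hUc : #(S.image f) ≤ #S := card_image_le
  obtain ⟨w, hw, hwc⟩ := hR.exists_free (U := S.image f) (c := #(T.ch y)) sdiff_subset
    (mem_image_of_mem f hp) hH.deg_false hH.pos hcm (by omega) hO
  obtain ⟨hwN, hwU⟩ := mem_sdiff.mp hw
  have hwP : w ∈ P false := relNbr_subset true _ hwN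
  have : Nonempty V := ⟨v⟩
  obtain ⟨e, he, heN⟩ := exists_injOn_of_card_le hwc
  have hdisj := h.disjoint_ch hyS
  let F : W → V := fun x => if x ∈ S then f x else if x = y then w else e x
  have hFS : ∀ x ∈ S, F x = f x := fun x hx => if_pos hx
  have hFy : F y = w := by simp [F, hyS]
  have hFc : ∀ x ∈ T.ch y, F x = e x := fun x hx => by
    have h₁ : x ∉ S := fun h' => disjoint_left.mp hdisj h' hx
    have h₂ : x ≠ y := fun e => notMem_ch_self (e ▸ hx)
    simp [F, h₁, h₂]
  have hew : ∀ x ∈ T.ch y, e x ∈ relNbr R P false w := fun x hx => (mem_sdiff.mp (heN x hx)).1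
  have heU : ∀ x ∈ T.ch y, e x ∉ S.image f := fun x hx => (mem_sdiff.mp (heN x hx)).2
  have hsc : ∀ x ∈ T.ch y, side x = true := fun x hx => by
    obtain ⟨a₁, a₂, a₃⟩ := mem_ch.mp hx
    rw [hs.par x a₁ a₂, a₃, hsy]
    rfl
  have hI := h.toIsInitial.insert_next hy hp
  have hcases : ∀ x ∈ insert y S ∪ T.ch y, x = y ∨ x ∈ S ∨ x ∈ T.ch y := fun x hx => by
    simpa [or_assoc] using hx
  refine ⟨insert y S ∪ T.ch y, F, subset_union_left, ⟨?_, ?_, ?_⟩, ?_, ?_, ?_, ?_, ?_⟩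
  · exact union_subset hI.subset (filter_subset _ _)
  · exact mem_union_left _ hI.root_mem
  · intro x hx hxr
    rcases mem_union.mp hx with hx | hx
    · exact mem_union_left _ (hI.par_mem x hx hxr)
    · rw [(mem_ch.mp hx).2.2]
      exact mem_union_left _ (mem_insert_self _ _)
  · rw [hFS _ h.root_mem, h.map_root]
  · intro x hx hxs
    rcases hcases x hx with rfl | hx | hx
    · exact subset_union_right
    · exact (h.ch_subset x hx hxs).trans ((subset_insert _ _).trans subset_union_left)
    · rw [hsc x hx] at hxs
      exact absurd hxs (by simp)
  · intro x hx
    rcases hcases x hx with rfl | hx | hx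
    · rw [hFy, hsy]; exact hwP
    · rw [hFS x hx]; exact h.mem_part x hx
    · rw [hFc x hx, hsc x hx]
      exact relNbr_subset false w (hew x hx)
  · have hyc : ∀ x ∈ T.ch y, w ≠ e x := fun x hx e' => hR.irrefl false P w (by
      have := hew x hx
      rwa [← e'] at this)
    have hyS' : ∀ x ∈ S, w ≠ f x := fun x hx e' => hwU (e' ▸ mem_image_of_mem f hx)
    have hSc' : ∀ x ∈ S, ∀ x' ∈ T.ch y, f x ≠ e x' := fun x hx x' hx' e' =>
      heU x' hx' (e' ▸ mem_image_of_mem f hx)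
    intro x hxX x' hxX' hxx
    rcases hcases x hxX with rfl | hx | hx <;> rcases hcases x' hxX' with rfl | hx' | hx'
    · rfl
    · rw [hFy, hFS x' hx'] at hxx; exact absurd hxx (hyS' x' hx')
    · rw [hFy, hFc x' hx'] at hxx; exact absurd hxx (hyc x' hx')
    · rw [hFy, hFS x hx] at hxx; exact absurd hxx.symm (hyS' x hx)
    · rw [hFS x hx, hFS x' hx'] at hxx; exact h.injOn hx hx' hxx
    · rw [hFS x hx, hFc x' hx'] at hxx; exact absurd hxx (hSc' x hx x' hx')
    · rw [hFy, hFc x hx] at hxx; exact absurd hxx.symm (hyc x hx)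
    · rw [hFS x' hx', hFc x hx] at hxx; exact absurd hxx.symm (hSc' x' hx' x hx)
    · rw [hFc x hx, hFc x' hx'] at hxx; exact he hx hx' hxx
  · intro x hx hxr
    rcases hcases x hx with rfl | hx | hx
    · rw [hFy, ← hpdef, hFS p hp, hsp]; exact hwN
    · rw [hFS x hx, hFS _ (h.par_mem x hx hxr)]; exact h.edge x hx hxr
    · rw [hFc x hx, (mem_ch.mp hx).2.2, hFy, hsy]; exact hew x hx

theorem LookHost.exists_embedding (hH : T.LookHost R P v d m σ) (hR : Sparse R σ)
    (hs : T.IsSide side) (hv : v ∈ P true) :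
    ∃ g : W → V, Set.InjOn g T.verts ∧ g T.root = v ∧
      ∀ w ∈ T.verts, w ≠ T.root → g w ∈ relNbr R P (side (T.par w)) (g (T.par w)) := by
  classical
  have h₀ : T.LookEmb side R P v {T.root} (fun _ => v) := by
    refine ⟨⟨by simpa using T.root_mem, by simp, ?_⟩, rfl, ?_, ?_, by simp, ?_⟩ <;> intro w hw <;>
      obtain rfl := mem_singleton.mp hw
    · exact fun h => absurd rfl h
    · rw [hs.root]
      exact fun h => absurd h (by simp)
    · rw [hs.root]; exact hv
    · exact fun h => absurd rfl h
  obtain ⟨S, hS, hmax⟩ := exists_max_image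
    (T.verts.powerset.filter (fun S => ∃ f, T.LookEmb side R P v S f)) card
    ⟨{T.root}, by simpa using ⟨T.root_mem, _, h₀⟩⟩
  obtain ⟨_, f, hf⟩ := mem_filter.mp hS
  have hall : S = T.verts := by
    refine hf.subset.antisymm fun q hq => ?_
    by_contra hqS
    obtain ⟨y, hyS, S', f', hsub, hf'⟩ := hf.exists_extend hR hs hH hq hqS
    have h₁ := hmax S' (mem_filter.mpr ⟨mem_powerset.mpr hf'.subset, f', hf'⟩)
    have h₂ := card_le_card hsub
    rw [card_insert_of_notMem hyS] at h₂
    omega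
  subst hall
  exact ⟨f, hf.injOn, hf.map_root, hf.edge⟩

end ParentTree

section Peel

variable {V : Type*} {R : V → V → Bool}

theorem sum_card_relNbr (P : Bool → Finset V) (s : Bool) :
    ∑ a ∈ P s, #(relNbr R P s a) = ∑ a ∈ P true, #(relNbr R P true a) := by
  cases s
  · exact (sum_card_bipartiteAbove_eq_sum_card_bipartiteBelow (s := P true) (t := P false)
      (fun a b => R a b = true)).symm
  · rfl

/-- A bipartite graph with many edges contains a subgraph, still with many edges, in which all
degrees are large. -/
theorem exists_peel [DecidableEq V] (c : ℕ) (α : Bool → ℕ) (P : Bool → Finset V)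
    (h : α true * #(P true) + α false * #(P false) < c * ∑ a ∈ P true, #(relNbr R P true a)) :
    ∃ Q : Bool → Finset V, (∀ s, Q s ⊆ P s) ∧
      α true * #(Q true) + α false * #(Q false) < c * ∑ a ∈ Q true, #(relNbr R Q true a) ∧
      ∀ s, ∀ a ∈ Q s, α s < c * #(relNbr R Q s a) := by
  induction hn : #(P true) + #(P false) using Nat.strong_induction_on generalizing P with
  | _ n ih =>
    by_cases hall : ∀ s, ∀ a ∈ P s, α s < c * #(relNbr R P s a)
    · exact ⟨P, fun _ => subset_rfl, h, hall⟩
    push Not at hall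
    obtain ⟨s, a, ha, hdeg⟩ := hall
    set P' := Function.update P s ((P s).erase a) with hP'
    have hsub : ∀ t, P' t ⊆ P t := by
      intro t
      by_cases ht : t = s
      · subst ht; rw [hP', Function.update_self]; exact erase_subset _ _
      · rw [hP', Function.update_of_ne ht]
    have hPs : P' s = (P s).erase a := Function.update_self _ _ _
    have hPn : P' (!s) = P (!s) := Function.update_of_ne (by simp) _ _
    have hcard : #(P' s) + 1 = #(P s) := by rw [hPs]; exact card_erase_add_one ha
    have hedges : ∑ b ∈ P true, #(relNbr R P true b) =
        ∑ b ∈ P' true, #(relNbr R P' true b) + #(relNbr R P s a) := by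
      rw [← sum_card_relNbr P s, ← sum_card_relNbr P' s, hPs, ← sum_erase_add _ _ ha]
      congr 1
      refine sum_congr rfl fun b _ => ?_
      rw [relNbr, relNbr, hPn]
    have hweight : α true * #(P true) + α false * #(P false) =
        α true * #(P' true) + α false * #(P' false) + α s := by
      cases s
      · rw [← hcard, show P' true = P true from hPn]; ring
      · rw [← hcard, show P' false = P false from hPn]; ring
    have hlt : #(P' true) + #(P' false) < n := by
      cases s
      · have : #(P' true) = #(P true) := by rw [show P' true = P true from hPn]
        omega
      · have : #(P' false) = #(P false) := by rw [show P' false = P false from hPn]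
        omega
    obtain ⟨Q, hQ, h₁, h₂⟩ := ih _ hlt P' (by rw [hedges, hweight, mul_add] at h; omega) rfl
    exact ⟨Q, fun t => (hQ t).trans (hsub t), h₁, h₂⟩

end Peel

namespace ParentTree

variable {V W : Type*} [DecidableEq V] [DecidableEq W] [Fintype V]
variable {T : ParentTree W} {R : V → V → Bool} {P Q : Bool → Finset V} {v : V} {δ σ C : ℕ}
  {side : W → Bool}

theorem Bounds.exists_embedding (hB : T.Bounds C δ σ) (hR : Sparse R σ) (hs : T.IsSide side)
    (hPQ : ∀ s, P s ⊆ Q s) (hv : v ∈ P true)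
    (hδ : ∀ s, ∀ y ∈ P s, δ ≤ #(relNbr R P s y)) (hd : (T.ch T.root).Nonempty)
    (hdeg : #(T.ch T.root) ≤ #(relNbr R Q true v))
    (hnl : #((T.ch T.root).filter (fun w => (T.ch w).Nonempty)) ≤ #(relNbr R P true v))
    (h₁ : C + 2 + σ ≤ δ) (h₂ : 2 * C + 3 + 3 * σ ≤ 2 * δ) :
    ∃ g : W → V, Set.InjOn g T.verts ∧ g T.root = v ∧
      ∀ w ∈ T.verts, w ≠ T.root → g w ∈ relNbr R Q (side (T.par w)) (g (T.par w)) := by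
  classical
  let G : W → V → Finset V := fun x y =>
    if x = T.root then if y = v then relNbr R Q true v else ∅ else relNbr R P (side x) y
  let J : W → Finset V := fun x => if x = T.root then {v} else P (side x)
  have hGv : G T.root v = relNbr R Q true v := by simp [G]
  have hGr : ∀ y, G T.root y ⊆ relNbr R Q true y := fun y => by
    by_cases hy : y = v
    · subst hy; rw [hGv]
    · simp [G, hy]
  have hGn : ∀ x, x ≠ T.root → ∀ y, G x y = relNbr R P (side x) y := fun x hx y => if_neg hx
  have hJr : J T.root = {v} := if_pos rfl
  have hJn : ∀ x, x ≠ T.root → J x = P (side x) := fun x hx => if_neg hx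
  have hGQ : ∀ x y, G x y ⊆ relNbr R Q (side x) y := fun x y => by
    by_cases hx : x = T.root
    · rw [hx, hs.root]; exact hGr y
    · rw [hGn x hx]; exact relNbr_mono hPQ _ _
  have hH : T.Host G J v δ σ := by
    refine ⟨by simp [hJr], ?_, ?_, ?_, ?_⟩
    · intro x y hy
      by_cases hx : x = T.root
      · rw [hx, hJr, mem_singleton] at hy
        rw [hx, hy, hGv]
        exact (hδ true v hv).trans (card_le_card (relNbr_mono hPQ _ _))
      · rw [hJn x hx] at hy
        rw [hGn x hx]
        exact hδ _ y hy
    · exact fun x y h => hR.irrefl _ _ _ (hGQ x y h)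
    · exact fun x x' y z hyz =>
        (card_le_card (inter_subset_inter (hGQ x y) (hGQ x' z))).trans (hR.codeg _ _ hyz)
    · intro w hw hwr hpr y _
      rw [hGn _ hpr, hJn w hwr, hs.par w hw hwr]
      exact relNbr_subset _ _
  obtain ⟨g, hg, hgr, hge⟩ := hH.exists_embedding hB hd (by rwa [hGv]) (relNbr R P true v)
    (by rw [hGv]; exact relNbr_mono hPQ _ _) hnl (fun w hw => by
      obtain ⟨a₁, a₂, a₃⟩ := mem_ch.mp hw
      rw [hJn w a₂, hs.par w a₁ a₂, a₃, hs.root]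
      exact relNbr_subset _ _) h₁ h₂
  exact ⟨g, hg, hgr, fun w hw hwr => hGQ _ _ (hge w hw hwr)⟩

/-- The tree without the leaves adjacent to the root. -/
def prune (T : ParentTree W) : ParentTree W where
  verts := T.verts.filter (fun w => w ∈ T.ch T.root → (T.ch w).Nonempty)
  root := T.root
  par := T.par
  rk := T.rk
  root_mem := mem_filter.mpr ⟨T.root_mem, fun h => absurd h notMem_ch_self⟩
  par_mem w hw hwr := mem_filter.mpr ⟨T.par_mem w (mem_filter.mp hw).1 hwr,
    fun _ => ⟨w, mem_ch.mpr ⟨(mem_filter.mp hw).1, hwr, rfl⟩⟩⟩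
  rk_par w hw hwr := T.rk_par w (mem_filter.mp hw).1 hwr

theorem prune_verts_subset : T.prune.verts ⊆ T.verts := filter_subset _ _

theorem ch_prune_root :
    T.prune.ch T.root = (T.ch T.root).filter (fun w => (T.ch w).Nonempty) := by
  ext w
  rw [mem_ch, mem_filter, mem_ch]
  change w ∈ T.verts.filter (fun w => w ∈ T.ch T.root → (T.ch w).Nonempty) ∧
    w ≠ T.root ∧ T.par w = T.root ↔ _
  rw [mem_filter, mem_ch]
  tauto

theorem ch_prune_of_ne {x : W} (hx : x ≠ T.root) : T.prune.ch x = T.ch x := by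
  ext w
  simp only [ch, prune, mem_filter]
  constructor
  · tauto
  · rintro ⟨h₁, h₂, h₃⟩
    exact ⟨⟨h₁, fun h => absurd (h₃.symm.trans h.2.2) hx⟩, h₂, h₃⟩

theorem ch_prune_nonempty {w : W} (hw : w ∈ T.prune.ch T.prune.root) :
    (T.prune.ch w).Nonempty := by
  have hwr : w ≠ T.root := (mem_ch.mp hw).2.1
  rw [ch_prune_of_ne hwr]
  have hw' : w ∈ T.prune.ch T.root := hw
  rw [ch_prune_root] at hw'
  exact (mem_filter.mp hw').2

theorem card_prune_verts :
    #T.prune.verts + #(T.ch T.root) = #T.verts + #(T.prune.ch T.root) := by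
  have h₁ := card_filter_add_card_filter_not (s := T.verts)
    (fun w => w ∈ T.ch T.root → (T.ch w).Nonempty)
  have h₂ := card_filter_add_card_filter_not (s := T.ch T.root)
    (fun w => (T.ch w).Nonempty)
  have h₃ : T.verts.filter (fun w => ¬ (w ∈ T.ch T.root → (T.ch w).Nonempty)) =
      (T.ch T.root).filter (fun w => ¬ (T.ch w).Nonempty) := by
    ext w
    simp only [mem_filter, mem_ch]
    tauto
  rw [h₃] at h₁
  rw [ch_prune_root]
  change #(T.verts.filter (fun w => w ∈ T.ch T.root → (T.ch w).Nonempty)) + _ = _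
  omega

theorem IsSide.prune (hs : T.IsSide side) : T.prune.IsSide side :=
  ⟨hs.root, fun w hw hwr => hs.par w (prune_verts_subset hw) hwr⟩

/-- The leaves at the root are placed last. -/
theorem exists_embedding_of_prune (hR : Sparse R σ) (hs : T.IsSide side)
    (hv : #T.verts ≤ #(relNbr R Q true v) + 1)
    (h : ∃ g : W → V, Set.InjOn g T.prune.verts ∧ g T.root = v ∧
      ∀ w ∈ T.prune.verts, w ≠ T.root → g w ∈ relNbr R Q (side (T.par w)) (g (T.par w))) :
    ∃ g : W → V, Set.InjOn g T.verts ∧ g T.root = v ∧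
      ∀ w ∈ T.verts, w ≠ T.root → g w ∈ relNbr R Q (side (T.par w)) (g (T.par w)) := by
  classical
  obtain ⟨g, hg, hgr, hge⟩ := h
  have hroot : T.root ∈ T.prune.verts := T.prune.root_mem
  set U := T.prune.verts.image g with hU
  have hvU : v ∈ U := hgr ▸ mem_image_of_mem g hroot
  have hcard : #(T.verts \ T.prune.verts) ≤ #(relNbr R Q true v \ U) := by
    have a₁ := card_sdiff_add_card_eq_card (prune_verts_subset (T := T))
    have a₂ : relNbr R Q true v ⊆ (relNbr R Q true v \ U) ∪ U.erase v := by
      intro t ht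
      simp only [mem_union, mem_sdiff, mem_erase]
      by_cases htU : t ∈ U
      · exact Or.inr ⟨fun e => hR.irrefl true Q v (e ▸ ht), htU⟩
      · exact Or.inl ⟨ht, htU⟩
    have a₃ := (card_le_card a₂).trans (card_union_le _ _)
    have a₄ : #U ≤ #T.prune.verts := card_image_le
    rw [card_erase_of_mem hvU] at a₃
    have := card_pos.mpr ⟨v, hvU⟩
    omega
  have : Nonempty V := ⟨v⟩
  obtain ⟨e, he, heN⟩ := exists_injOn_of_card_le hcard
  have hch : ∀ w ∈ T.verts, w ∉ T.prune.verts → w ∈ T.ch T.root := by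
    intro w hw hwp
    by_contra hc
    exact hwp (mem_filter.mpr ⟨hw, fun h => absurd h hc⟩)
  let F : W → V := fun w => if w ∈ T.prune.verts then g w else e w
  have hFg : ∀ w ∈ T.prune.verts, F w = g w := fun w hw => if_pos hw
  have hFe : ∀ w, w ∉ T.prune.verts → F w = e w := fun w hw => if_neg hw
  have hFr : F T.root = v := (hFg _ hroot).trans hgr
  refine ⟨F, ?_, hFr, ?_⟩
  · intro x hx y hy hxy
    by_cases hx' : x ∈ T.prune.verts <;> by_cases hy' : y ∈ T.prune.verts
    · rw [hFg x hx', hFg y hy'] at hxy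
      exact hg hx' hy' hxy
    · rw [hFg x hx', hFe y hy'] at hxy
      exact absurd (hxy ▸ mem_image_of_mem g hx')
        (mem_sdiff.mp (heN y (mem_sdiff.mpr ⟨hy, hy'⟩))).2
    · rw [hFe x hx', hFg y hy'] at hxy
      exact absurd (hxy ▸ mem_image_of_mem g hy')
        (mem_sdiff.mp (heN x (mem_sdiff.mpr ⟨hx, hx'⟩))).2
    · rw [hFe x hx', hFe y hy'] at hxy
      exact he (mem_coe.mpr (mem_sdiff.mpr ⟨hx, hx'⟩)) (mem_coe.mpr (mem_sdiff.mpr ⟨hy, hy'⟩)) hxy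
  · intro w hw hwr
    by_cases hw' : w ∈ T.prune.verts
    · rw [hFg w hw', hFg (T.par w) (T.prune.par_mem w hw' hwr)]
      exact hge w hw' hwr
    · rw [(mem_ch.mp (hch w hw hw')).2.2, hs.root, hFr, hFe w hw']
      exact (mem_sdiff.mp (heN w (mem_sdiff.mpr ⟨hw, hw'⟩))).1

theorem verts_eq_of_ch_root_eq_empty (h : T.ch T.root = ∅) : T.verts = {T.root} := by
  have hI : T.IsInitial {T.root} := by
    refine ⟨by simpa using T.root_mem, by simp, ?_⟩
    intro w hw
    obtain rfl := mem_singleton.mp hw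
    exact fun h => absurd rfl h
  refine Subset.antisymm (fun w hw => ?_) hI.subset
  by_contra hw'
  obtain ⟨y, hy, hyS, hp, -⟩ := hI.exists_next hw hw'
  have : y ∈ T.ch T.root :=
    mem_ch.mpr ⟨hy, fun e => hyS (mem_singleton.mpr e), mem_singleton.mp hp⟩
  rw [h] at this
  exact notMem_empty _ this

end ParentTree

theorem part_nonempty_of_lt {V : Type*} {R : V → V → Bool} {c x : ℕ} {Q : Bool → Finset V}
    (h : x < c * ∑ a ∈ Q true, #(relNbr R Q true a)) : (Q true).Nonempty := by
  rw [nonempty_iff_ne_empty]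
  intro h0
  rw [h0, sum_empty, mul_zero] at h
  exact absurd h (Nat.not_lt_zero _)

namespace ParentTree

variable {V W : Type*} [DecidableEq V] [DecidableEq W] [Fintype V]
variable {T : ParentTree W} {R : V → V → Bool} {k : ℕ} {side : W → Bool}

theorem card_nonleaf_add_card_lt :
    #((T.ch T.root).filter (fun w => (T.ch w).Nonempty)) + #(T.ch T.root) < #T.verts := by
  classical
  have hr : T.root ∉ (T.ch T.root).filter (fun w => (T.ch w).Nonempty) :=
    fun h => notMem_ch_self (mem_filter.mp h).1
  have h := T.sum_card_ch_lt (insert T.root ((T.ch T.root).filter (fun w => (T.ch w).Nonempty)))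
  rw [sum_insert hr] at h
  have h₂ := card_nsmul_le_sum ((T.ch T.root).filter (fun w => (T.ch w).Nonempty))
    (fun w => #(T.ch w)) 1 (fun w hw => card_pos.mpr (mem_filter.mp hw).2)
  rw [smul_eq_mul, mul_one] at h₂
  omega

/-- A part of a bipartite graph with more than `(k - 1) / 2` edges per vertex contains a vertex from
which the tree can be embedded, provided the root fits into the bigger graph. -/
theorem exists_embedding_of_average (hk : 13 ≤ k) (hs : T.IsSide side)
    (hR : Sparse R ((k - 1) / 12)) (hK : #T.verts ≤ k + 1)
    (hC : ∀ x ∈ T.verts, x ≠ T.root → #(T.ch x) ≤ k / 4 + 1)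
    (hd : k / 4 + 1 ≤ #(T.ch T.root)) {Q : Bool → Finset V}
    (hdeg : #(T.ch T.root) ≤ (k + 1) / 2 ∨
      ∀ a ∈ Q true, #(T.ch T.root) ≤ #(relNbr R Q true a))
    (hQ : (k - 1) * #(Q true) + (k - 1) * #(Q false) <
      2 * ∑ a ∈ Q true, #(relNbr R Q true a)) :
    ∃ g : W → V, Set.InjOn g T.verts ∧
      ∀ w ∈ T.verts, w ≠ T.root → g w ∈ relNbr R Q (side (T.par w)) (g (T.par w)) := by
  obtain ⟨P, hPQ, hP, hα⟩ := exists_peel 2 (fun _ => k - 1) Q hQ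
  obtain ⟨v, hv⟩ := part_nonempty_of_lt hP
  have hδ : ∀ s, ∀ y ∈ P s, (k + 1) / 2 ≤ #(relNbr R P s y) := fun s y hy => by
    have := hα s y hy
    omega
  have hvδ := hδ true v hv
  have hvQ : #(relNbr R P true v) ≤ #(relNbr R Q true v) := card_le_card (relNbr_mono hPQ _ _)
  have hnl := T.card_nonleaf_add_card_lt
  have hnd := card_filter_le (T.ch T.root) (fun w => (T.ch w).Nonempty)
  have hB : T.Bounds (k / 4 + 1) ((k + 1) / 2) ((k - 1) / 12) := by
    refine ⟨hC, ?_, ?_, Or.inr ⟨?_, ?_⟩, ?_, ?_, ?_, ?_, ?_⟩ <;> omega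
  have hk₂ : 2 * (k / 4 + 1) + 3 + 3 * ((k - 1) / 12) ≤ 2 * ((k + 1) / 2) := by
    rcases lt_or_ge k 20 with h | h
    · interval_cases k <;> decide
    · omega
  have hdeg' : #(T.ch T.root) ≤ #(relNbr R Q true v) :=
    hdeg.elim (fun h => h.trans (hvδ.trans hvQ)) (fun h => h v (hPQ _ hv))
  obtain ⟨g, h₁, -, h₂⟩ := hB.exists_embedding hR hs hPQ hv hδ (card_pos.mp (by omega)) hdeg'
    (by omega) (by omega) hk₂
  exact ⟨g, h₁, h₂⟩

/-- Embedding from a vertex of large degree. -/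
theorem exists_embedding_of_large_degree (hk : 13 ≤ k) (hs : T.IsSide side)
    (hR : Sparse R ((k - 1) / 12)) (hK : #T.verts ≤ k + 1)
    (hC : ∀ x ∈ T.verts, x ≠ T.root → #(T.ch x) ≤ k / 4 + 1)
    (hd : (k + 1) / 2 + 1 ≤ #(T.ch T.root)) {m : ℕ} (hm : #(T.ch T.root) + m = k)
    {Q : Bool → Finset V} {v : V} (hv : v ∈ Q true) (hkv : k ≤ #(relNbr R Q true v))
    (htrue : ∀ y ∈ Q true, #(T.ch T.root) ≤ #(relNbr R Q true y))
    (hfalse : ∀ y ∈ Q false, m + 1 ≤ #(relNbr R Q false y)) :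
    ∃ g : W → V, Set.InjOn g T.verts ∧
      ∀ w ∈ T.verts, w ≠ T.root → g w ∈ relNbr R Q (side (T.par w)) (g (T.par w)) := by
  have hpv := T.card_prune_verts
  have hnl := T.card_nonleaf_add_card_lt
  rw [← ch_prune_root] at hnl
  suffices h : ∃ g : W → V, Set.InjOn g T.prune.verts ∧ g T.root = v ∧
      ∀ w ∈ T.prune.verts, w ≠ T.root → g w ∈ relNbr R Q (side (T.par w)) (g (T.par w)) by
    obtain ⟨g, h₁, -, h₂⟩ := exists_embedding_of_prune hR hs (by omega) h
    exact ⟨g, h₁, h₂⟩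
  rcases (T.prune.ch T.prune.root).eq_empty_or_nonempty with he | hne
  · have hv1 : T.prune.verts = {T.root} := verts_eq_of_ch_root_eq_empty he
    refine ⟨fun _ => v, ?_, rfl, ?_⟩
    · rw [hv1, coe_singleton]; exact Set.injOn_singleton _ _
    · intro w hw hwr
      exact absurd (mem_singleton.mp (hv1 ▸ hw)) hwr
  have hcr : #(T.prune.ch T.prune.root) = #(T.prune.ch T.root) := rfl
  by_cases hcase : k + 2 ≤ 2 * m + 3 * ((k - 1) / 12)
  · have hδ : ∀ s, ∀ y ∈ Q s, m + 1 ≤ #(relNbr R Q s y) := by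
      intro s y hy
      cases s
      · exact hfalse y hy
      · have := htrue y hy; omega
    have hB : T.prune.Bounds (k / 4 + 1) (m + 1) ((k - 1) / 12) := by
      refine ⟨fun x hx hxr => ?_, ?_, ?_, Or.inl fun w hw => ch_prune_nonempty hw,
        ?_, ?_, ?_, ?_, ?_⟩
      · have hxr' : x ≠ T.root := hxr
        rw [ch_prune_of_ne hxr']
        exact hC x (prune_verts_subset hx) hxr'
      all_goals omega
    refine hB.exists_embedding hR hs.prune (fun _ => subset_rfl) hv hδ hne (by omega) ?_
      (by omega) (by omega)
    refine (card_filter_le _ _).trans (by omega)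
  · have hL : T.prune.LookHost R Q v #(T.ch T.root) m ((k - 1) / 12) := by
      refine ⟨fun w hw => ch_prune_nonempty hw, ?_, ?_, htrue, hfalse, ?_, ?_⟩ <;> omega
    exact hL.exists_embedding hR hs.prune hv

theorem exists_embedding (hk : 13 ≤ k) (hs : T.IsSide side)
    (hR : Sparse R ((k - 1) / 12)) (hK : #T.verts ≤ k + 1)
    (hC : ∀ x ∈ T.verts, x ≠ T.root → #(T.ch x) ≤ k / 4 + 1)
    (hd : k / 4 + 1 ≤ #(T.ch T.root))
    (hV : (k - 1) * Fintype.card V < ∑ a, #(relNbr R (fun _ => univ) true a)) :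
    ∃ g : W → V, Set.InjOn g T.verts ∧ ∀ w ∈ T.verts, w ≠ T.root →
      g w ∈ relNbr R (fun _ => univ) (side (T.par w)) (g (T.par w)) := by
  by_cases hcase : #(T.ch T.root) ≤ (k + 1) / 2
  · refine exists_embedding_of_average hk hs hR hK hC hd (Or.inl hcase) ?_
    rw [card_univ]
    omega
  obtain ⟨m, hm⟩ : ∃ m, #(T.ch T.root) + m = k :=
    ⟨_, Nat.add_sub_of_le (by have := T.card_nonleaf_add_card_lt; omega)⟩
  obtain ⟨n, hn⟩ : ∃ n, #(T.ch T.root) = n + 1 := ⟨_, (Nat.sub_add_cancel (by omega)).symm⟩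
  have hk1 : k - 1 = n + m := by omega
  obtain ⟨Q, -, hQ, hα⟩ := exists_peel (R := R) 1 (fun s => if s then n else m)
    (fun _ => univ) (by
      simp only [if_true, Bool.false_eq_true, if_false, one_mul, card_univ]
      rwa [hk1, add_mul] at hV)
  simp only [if_true, Bool.false_eq_true, if_false, one_mul] at hQ hα
  have htrue : ∀ y ∈ Q true, #(T.ch T.root) ≤ #(relNbr R Q true y) := fun y hy => by
    have := hα true y hy
    simp only [if_true] at this
    omega
  have hfalse : ∀ y ∈ Q false, m + 1 ≤ #(relNbr R Q false y) := fun y hy => by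
    have := hα false y hy
    simp only [Bool.false_eq_true, if_false] at this
    omega
  suffices h : ∃ g : W → V, Set.InjOn g T.verts ∧
      ∀ w ∈ T.verts, w ≠ T.root → g w ∈ relNbr R Q (side (T.par w)) (g (T.par w)) by
    obtain ⟨g, h₁, h₂⟩ := h
    exact ⟨g, h₁, fun w hw hwr => relNbr_mono (fun _ => subset_univ _) _ _ (h₂ w hw hwr)⟩
  by_cases hbig : ∃ v ∈ Q true, k ≤ #(relNbr R Q true v)
  · obtain ⟨v, hv, hkv⟩ := hbig
    exact exists_embedding_of_large_degree hk hs hR hK hC (by omega) hm hv hkv htrue hfalse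
  · push Not at hbig
    refine exists_embedding_of_average hk hs hR hK hC hd (Or.inr htrue) ?_
    have he : ∑ a ∈ Q true, #(relNbr R Q true a) ≤ #(Q true) * (n + m) :=
      sum_le_card_nsmul _ _ _ fun a ha => by have := hbig a ha; omega
    rw [hk1]
    obtain ⟨j, rfl⟩ : ∃ j, n = m + j := ⟨n - m, by omega⟩
    have hqp : #(Q false) ≤ #(Q true) := by
      have h₁ : m * #(Q false) < m * #(Q true) := by nlinarith
      exact (Nat.lt_of_mul_lt_mul_left h₁).le
    nlinarith [Nat.mul_le_mul_left j hqp]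

end ParentTree

theorem SimpleGraph.IsTree.exists_parent {W : Type*} {G : SimpleGraph W} (hG : G.IsTree) (u : W) :
    ∃ par : W → W, (∀ w, w ≠ u → G.Adj w (par w) ∧ G.dist (par w) u < G.dist w u) ∧
      ∀ x y, G.Adj x y → (x ≠ u ∧ par x = y) ∨ (y ≠ u ∧ par y = x) := by
  choose p hp hpl using fun w => hG.connected.exists_path_of_dist w u
  refine ⟨fun w => (p w).snd, fun w hw => ?_, fun x y hxy => ?_⟩
  · have hn := Walk.not_nil_of_ne (p := p w) hw
    refine ⟨(p w).adj_snd hn, ?_⟩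
    have := Walk.length_tail_add_one hn
    have := dist_le (p w).tail
    change G.dist (p w).snd u < _
    rw [← hpl w]
    omega
  · have key : ∀ a b, G.Adj a b → G.dist a u = G.dist b u + 1 → a ≠ u ∧ (p a).snd = b := by
      intro a b hab h
      have hq : (Walk.cons hab (p b)).IsPath :=
        Walk.isPath_of_length_eq_dist _ (by rw [Walk.length_cons, hpl, h])
      have he : p a = Walk.cons hab (p b) :=
        congrArg Subtype.val ((hG.isAcyclic.subsingleton_path a u).elim ⟨p a, hp a⟩ ⟨_, hq⟩)
      refine ⟨?_, by rw [he, Walk.snd_cons]⟩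
      rintro rfl
      simp at h
    have h := hG.dist_eq_dist_add_one_of_adj u hxy
    rw [G.dist_comm, G.dist_comm (u := u)] at h
    rcases h with h | h
    · exact Or.inl (key x y hxy h)
    · exact Or.inr (key y x hxy.symm h)

section Digraph

variable {V W : Type*}
variable {D : V → V → Bool} {T : W → W → Bool}

theorem underG_adj_iff (hT : Antidirected T) {x y : W} :
    (underG T).Adj x y ↔ T x y = true ∨ T y x = true := by
  rw [underG, SimpleGraph.fromRel_adj]
  refine ⟨fun h => h.2, fun h => ⟨?_, h⟩⟩
  rintro rfl
  exact h.elim (fun h => hT _ _ _ h h) (fun h => hT _ _ _ h h)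

/-- A rooted tree with all its vertices is a rooted version of the underlying tree of `T`. -/
structure ParentTree.Roots (P : ParentTree W) (T : W → W → Bool) : Prop where
  mem_verts : ∀ w, w ∈ P.verts
  arc_par : ∀ w, w ≠ P.root → T w (P.par w) = true ∨ T (P.par w) w = true
  par_eq : ∀ x y, T x y = true ∨ T y x = true →
    (x ≠ P.root ∧ P.par x = y) ∨ (y ≠ P.root ∧ P.par y = x)

theorem ParentTree.Roots.par_par_ne {P : ParentTree W} (h : P.Roots T) {w : W} (hw : w ≠ P.root) (hpw : P.par w ≠ P.root) :
    P.par (P.par w) ≠ w := by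
  intro e
  have h₁ := P.rk_par w (h.mem_verts w) hw
  have h₂ := P.rk_par (P.par w) (h.mem_verts _) hpw
  rw [e] at h₂
  exact lt_asymm h₁ h₂

variable [Fintype W]

theorem exists_totalDeg_eq_maxDeg [Nonempty W] : ∃ u, totalDeg T u = maxDeg T := by
  obtain ⟨u, -, hu⟩ := exists_mem_eq_sup univ univ_nonempty (totalDeg T)
  exact ⟨u, hu.symm⟩

variable [Fintype V]

theorem sum_card_nbr (s : Bool) : ∑ a, #(nbr D s a) = arcCount D := by
  cases s
  · rw [arcCount, card_filter, ← univ_product_univ, sum_product_right]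
    exact sum_congr rfl fun a _ => card_filter _ _
  · rw [arcCount, card_filter, ← univ_product_univ, sum_product]
    exact sum_congr rfl fun a _ => card_filter _ _

theorem notMem_nbr (hD : Loopless D) (s : Bool) (a : V) : a ∉ nbr D s a := by
  have := hD a
  cases s <;> simpa [nbr, outNbr, inNbr] using this

/-- `D` if `s` is `true`, and the reversal of `D` otherwise. -/
def orient (D : V → V → Bool) (s : Bool) (a b : V) : Bool := if s then D a b else D b a

theorem relNbr_orient (s t : Bool) (a : V) :
    relNbr (orient D s) (fun _ => univ) t a = nbr D (t == s) a := by
  cases s <;> cases t <;> rfl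

theorem exists_parentTree (hT : Antidirected T) (htree : (underG T).IsTree) (u : W) :
    ∃ P : ParentTree W, P.root = u ∧ P.Roots T := by
  obtain ⟨par, h₁, h₂⟩ := htree.exists_parent u
  exact ⟨⟨univ, u, par, fun w => (underG T).dist w u, mem_univ _, fun _ _ _ => mem_univ _,
    fun w _ hw => (h₁ w hw).2⟩, rfl, mem_univ, fun w hw => (underG_adj_iff hT).mp (h₁ w hw).1,
    fun x y hxy => h₂ x y ((underG_adj_iff hT).mpr hxy)⟩

variable [DecidableEq W]

theorem totalDeg_eq_card_union (hT : Antidirected T) (w : W) :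
    totalDeg T w = #(outNbr T w ∪ inNbr T w) := by
  rw [card_union_of_disjoint, totalDeg]
  rw [disjoint_left]
  intro x h₁ h₂
  exact hT _ _ _ (mem_filter.mp h₁).2 (mem_filter.mp h₂).2

theorem mem_outNbr_union_inNbr {w x : W} :
    x ∈ outNbr T w ∪ inNbr T w ↔ T w x = true ∨ T x w = true := by
  simp [outNbr, inNbr]

namespace ParentTree.Roots

variable {P : ParentTree W}

theorem totalDeg_root_le (h : P.Roots T) (hT : Antidirected T) :
    totalDeg T P.root ≤ #(P.ch P.root) := by
  rw [totalDeg_eq_card_union hT]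
  refine card_le_card fun x hx => ?_
  rcases h.par_eq _ _ (mem_outNbr_union_inNbr.mp hx) with h₁ | h₁
  · exact absurd rfl h₁.1
  · exact ParentTree.mem_ch.mpr ⟨h.mem_verts x, h₁⟩

theorem card_ch_lt_totalDeg (h : P.Roots T) (hT : Antidirected T) {w : W} (hw : w ≠ P.root) :
    #(P.ch w) < totalDeg T w := by
  have hp : P.par w ∉ P.ch w := fun hp =>
    h.par_par_ne hw (ParentTree.mem_ch.mp hp).2.1 (ParentTree.mem_ch.mp hp).2.2
  rw [totalDeg_eq_card_union hT, ← Nat.add_one_le_iff, ← card_insert_of_notMem hp]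
  refine card_le_card (insert_subset ?_ fun x hx => ?_) <;> rw [mem_outNbr_union_inNbr]
  · exact h.arc_par w hw
  · obtain ⟨-, hxr, rfl⟩ := ParentTree.mem_ch.mp hx
    exact (h.arc_par x hxr).symm

theorem card_verts_le (h : P.Roots T) : #P.verts ≤ arcCount T + 1 := by
  have hsub : P.verts ⊆ insert P.root ((univ.filter (fun p : W × W => T p.1 p.2)).image
      (fun p => if p.1 ≠ P.root ∧ P.par p.1 = p.2 then p.1 else p.2)) := by
    intro w _
    rw [mem_insert, mem_image]
    by_cases hw : w = P.root
    · exact Or.inl hw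
    right
    rcases h.arc_par w hw with ha | ha
    · exact ⟨(w, P.par w), by simpa using ha, if_pos ⟨hw, rfl⟩⟩
    · exact ⟨(P.par w, w), by simpa using ha, if_neg fun hc => h.par_par_ne hw hc.1 hc.2⟩
  exact (card_le_card hsub).trans ((card_insert_le _ _).trans
    (Nat.add_le_add_right card_image_le 1))

end ParentTree.Roots

theorem totalDeg_le_secondMaxDeg {u w : W} (hu : totalDeg T u = maxDeg T) (hw : w ≠ u) :
    totalDeg T w ≤ secondMaxDeg T := by
  refine Multiset.le_sup ?_
  have h : (univ : Finset W).val = u ::ₘ ((univ : Finset W).erase u).val := by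
    rw [← insert_val_of_notMem (notMem_erase u _), insert_erase (mem_univ u)]
  rw [h, Multiset.map_cons, hu, Multiset.erase_cons_head]
  exact Multiset.mem_map_of_mem _ (mem_erase.mpr ⟨hw, mem_univ w⟩)

theorem embeds_of_arcCount_eq_one (hloop : Loopless D) (hpos : 0 < arcCount D)
    (hT : Antidirected T) (htree : (underG T).IsTree) (hT1 : arcCount T = 1) : Embeds T D := by
  obtain ⟨⟨a, b⟩, hab⟩ := card_pos.mp hpos
  obtain ⟨⟨x, y⟩, hxy⟩ := card_eq_one.mp hT1
  have hD : D a b = true := (mem_filter.mp hab).2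
  have hne : a ≠ b := by rintro rfl; exact hloop a hD
  have hTxy : ∀ z w, T z w = true ↔ z = x ∧ w = y := fun z w => by
    have := Finset.ext_iff.mp hxy (z, w)
    simpa using this
  obtain ⟨P, rfl, hP⟩ := exists_parentTree hT htree x
  have hall : ∀ w, w = P.root ∨ w = y := fun w => by
    by_contra! hc
    rcases hP.arc_par w hc.1 with h | h
    · exact hc.1 ((hTxy _ _).mp h).1
    · exact hc.2 ((hTxy _ _).mp h).2
  have hyx : y ≠ P.root := by
    intro e
    have := (hTxy P.root y).mpr ⟨rfl, rfl⟩
    rw [e] at this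
    exact hT _ _ _ this this
  refine ⟨fun w => if w = P.root then a else b, fun z w hzw => ?_, fun z w hzw => ?_⟩
  · rcases hall z with rfl | rfl <;> rcases hall w with rfl | rfl <;> simp_all
  · obtain ⟨rfl, rfl⟩ := (hTxy _ _).mp hzw
    simpa [hyx] using hD

variable [DecidableEq V]

theorem K2sFree.card_inter_le (hD : Loopless D) {σ : ℕ} (h : K2sFree D (σ + 1)) (s s' : Bool)
    {a b : V} (hab : a ≠ b) : #(nbr D s a ∩ nbr D s' b) ≤ σ := by
  by_contra! hlt
  obtain ⟨S, hS, hSc⟩ := exists_subset_card_eq (Nat.succ_le_of_lt hlt)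
  exact h ⟨a, b, s, s', S, hab, hSc, fun ha => notMem_nbr hD s a (mem_inter.mp (hS ha)).1,
    fun hb => notMem_nbr hD s' b (mem_inter.mp (hS hb)).2, hS⟩

theorem sparse_orient (hD : Loopless D) {σ : ℕ} (h : K2sFree D (σ + 1)) (s : Bool) :
    Sparse (orient D s) σ where
  irrefl t P a ha := by
    have := relNbr_mono (fun _ => subset_univ _) _ _ ha
    rw [relNbr_orient] at this
    exact notMem_nbr hD _ _ this
  codeg_univ t t' a b hab := by
    rw [relNbr_orient, relNbr_orient]
    exact h.card_inter_le hD _ _ hab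

theorem embeds_of_thirteen_le {k : ℕ} (hk : 13 ≤ k) (hloop : Loopless D)
    (hfree : K2sFree D ((k - 1) / 12 + 1)) (harcs : (k - 1) * Fintype.card V < arcCount D)
    (hT : Antidirected T) (htree : (underG T).IsTree) (hkT : arcCount T = k)
    (hD : k / 4 < maxDeg T) (hD2 : secondMaxDeg T ≤ k / 4 + 2) : Embeds T D := by
  have := htree.connected.nonempty
  obtain ⟨u, hu⟩ := exists_totalDeg_eq_maxDeg (T := T)
  obtain ⟨P, rfl, hP⟩ := exists_parentTree hT htree u
  let sgn : W → Bool := fun w => decide (∃ y, T w y = true)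
  have hsgn : ∀ w z, T w z = true → sgn w = true ∧ sgn z = false := fun w z hwz =>
    ⟨decide_eq_true ⟨z, hwz⟩, decide_eq_false fun ⟨y, hy⟩ => hT _ _ _ hwz hy⟩
  have hside : P.IsSide (fun w => sgn w == sgn P.root) := by
    refine ⟨by simp, fun w _ hw => ?_⟩
    rcases hP.arc_par w hw with ha | ha <;> obtain ⟨h₁, h₂⟩ := hsgn _ _ ha <;>
      simp only [h₁, h₂] <;> cases sgn P.root <;> rfl
  have hroot := hP.totalDeg_root_le hT
  obtain ⟨g, hg, hge⟩ := ParentTree.exists_embedding hk hside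
    (sparse_orient hloop hfree (sgn P.root)) (hkT ▸ hP.card_verts_le)
    (fun w _ hw => by
      have h₁ := hP.card_ch_lt_totalDeg hT hw
      have h₂ := totalDeg_le_secondMaxDeg hu hw
      omega)
    (by omega) (by simp only [relNbr_orient, sum_card_nbr]; exact harcs)
  have hge' : ∀ w, w ≠ P.root → g w ∈ nbr D (sgn (P.par w)) (g (P.par w)) := fun w hw => by
    have := hge w (hP.mem_verts w) hw
    rw [relNbr_orient] at this
    convert this using 2
    cases sgn (P.par w) <;> cases sgn P.root <;> rfl
  refine ⟨g, fun x y hxy => hg (hP.mem_verts x) (hP.mem_verts y) hxy, fun x y hxy => ?_⟩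
  obtain ⟨h₁, h₂⟩ := hsgn _ _ hxy
  rcases hP.par_eq x y (Or.inl hxy) with ⟨hw, rfl⟩ | ⟨hw, rfl⟩
  · have := hge' x hw
    rw [h₂] at this
    exact (mem_filter.mp this).2
  · have := hge' y hw
    rw [h₁] at this
    exact (mem_filter.mp this).2

theorem arcCount_le_card_of_k2sFree_one (hloop : Loopless D) (h : K2sFree D 1) :
    arcCount D ≤ Fintype.card V := by
  rw [← sum_card_nbr true]
  refine (sum_le_card_nsmul univ _ 1 fun a _ => ?_).trans (by rw [smul_eq_mul, mul_one, card_univ])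
  rw [card_le_one]
  intro b hb c hc
  by_contra hbc
  have h₀ := K2sFree.card_inter_le (σ := 0) hloop h false false hbc
  rw [Nat.le_zero, card_eq_zero] at h₀
  have ha : a ∈ nbr D false b ∩ nbr D false c := by
    have hb' := (mem_filter.mp hb).2
    have hc' := (mem_filter.mp hc).2
    exact mem_inter.mpr ⟨mem_filter.mpr ⟨mem_univ _, hb'⟩, mem_filter.mpr ⟨mem_univ _, hc'⟩⟩
  rw [h₀] at ha
  exact notMem_empty _ ha

end Digraph

/-- If `Δ(T) > ⌊k/4⌋` and `Δ₂(T) ≤ ⌊k/4⌋ + 2`, then the antidirected tree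
`T` with `k` arcs embeds in every `𝒦_{2,s}`-free digraph with more than `(k−1)·|V(D)|`
arcs. -/
theorem stmt_13 (k : ℕ) (hk : 0 < k)
    {V : Type*} [Fintype V] [DecidableEq V]
    (D : V → V → Bool) (hloop : Loopless D)
    (hfree : K2sFree D ((k + 11) / 12))
    (harcs : (k - 1) * Fintype.card V < arcCount D)
    {W : Type*} [Fintype W] [DecidableEq W]
    (T : W → W → Bool) (hT : Antidirected T)
    (htree : (underG T).IsTree) (hkT : arcCount T = k)
    (hD : k / 4 < maxDeg T) (hD2 : secondMaxDeg T ≤ k / 4 + 2) :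
    Embeds T D := by
  have hs : (k + 11) / 12 = (k - 1) / 12 + 1 := by omega
  rw [hs] at hfree
  by_cases hk13 : 13 ≤ k
  · exact embeds_of_thirteen_le hk13 hloop hfree harcs hT htree hkT hD hD2
  have hs1 : (k - 1) / 12 + 1 = 1 := by omega
  rw [hs1] at hfree
  have hn := arcCount_le_card_of_k2sFree_one hloop hfree
  rcases Nat.lt_or_ge 1 k with hk1 | hk1
  · have := Nat.le_mul_of_pos_left (Fintype.card V) (show 0 < k - 1 by omega)
    omega
  · exact embeds_of_arcCount_eq_one hloop (by omega) hT htree (by omega)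
end

section
/- Let k be a positive integer and set s = ⌈k/12⌉. Let D be a 𝒦_{2,s}-free digraph and let D' be a subdigraph of D with minimum pseudo-semidegree at least ⌈k/2⌉. Let T be an antidirected tree with k arcs, and let u, v be distinct vertices of T such that u is an out-vertex with deg⁺(u) = Δ(T), and the total degree of v equals Δ₂(T) ≥ ⌊k/4⌋ + 3. If the double broom B_uv(T) has at most 3k/4 vertices, then B_uv(T) embeds in D'. -/
open Finset

section Broom

variable {V W : Type*}

lemma mem_nbr [Fintype V] {A : V → V → Bool} {b : Bool} {x y : V} :
    y ∈ nbr A b x ↔ (b = true ∧ A x y) ∨ (b = false ∧ A y x) := by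
  cases b <;> simp [nbr, outNbr, inNbr]

lemma underG_adj_of_arc {T : W → W → Bool} (hT : Antidirected T) {x y : W} (h : T x y) :
    (underG T).Adj x y := by
  rw [underG, SimpleGraph.fromRel_adj]
  refine ⟨?_, Or.inl h⟩
  rintro rfl
  exact hT x x x h h

lemma mem_outNbr_union_inNbr_s17 [Fintype W] [DecidableEq W] {T : W → W → Bool}
    (hT : Antidirected T) {x y : W} :
    y ∈ outNbr T x ∪ inNbr T x ↔ (underG T).Adj x y := by
  constructor
  · intro h
    simp only [outNbr, inNbr, mem_union, mem_filter, mem_univ, true_and] at h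
    rcases h with h | h
    · exact underG_adj_of_arc hT h
    · exact (underG_adj_of_arc hT h).symm
  · intro h
    rw [underG, SimpleGraph.fromRel_adj] at h
    simpa [outNbr, inNbr] using h.2

lemma card_outNbr_union_inNbr [Fintype W] [DecidableEq W] {T : W → W → Bool}
    (hT : Antidirected T) (x : W) :
    (outNbr T x ∪ inNbr T x).card = totalDeg T x := by
  rw [totalDeg, card_union_of_disjoint]
  rw [disjoint_left]
  intro y h1 h2
  simp only [outNbr, inNbr, mem_filter, mem_univ, true_and] at h1 h2
  exact hT x y x h1 h2

/-- The sign of a vertex of an antidirected digraph: `true` for out-vertices. -/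
def vertexSign [Fintype W] (T : W → W → Bool) (x : W) : Bool :=
  decide (0 < (outNbr T x).card)

lemma vertexSign_tail [Fintype W] {T : W → W → Bool} {x y : W} (h : T x y) :
    vertexSign T x = true := by
  simp only [vertexSign, decide_eq_true_eq, card_pos]
  exact ⟨y, by simpa [outNbr] using h⟩

lemma vertexSign_head [Fintype W] {T : W → W → Bool} (hT : Antidirected T) {x y : W}
    (h : T x y) : vertexSign T y = false := by
  simp only [vertexSign, decide_eq_false_iff_not, card_pos]
  rintro ⟨z, hz⟩
  exact hT x y z h (by simpa [outNbr] using hz)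

/-- In an acyclic graph, a vertex off a path and adjacent to its start
has no other neighbour on the path. -/
lemma SimpleGraph.IsAcyclic.eq_of_adj_of_mem_support [DecidableEq W] {G : SimpleGraph W}
    (hG : G.IsAcyclic) {a b w c : W} {q : G.Walk a b} (hq : q.IsPath) (hw : w ∉ q.support)
    (ha : G.Adj w a) (hc : G.Adj w c) (hcq : c ∈ q.support) : c = a := by
  have h1 : (SimpleGraph.Walk.cons ha (q.takeUntil c hcq)).IsPath :=
    (hq.takeUntil hcq).cons fun h => hw (q.support_takeUntil_subset_support hcq h)
  have h2 : (SimpleGraph.Walk.cons hc SimpleGraph.Walk.nil).IsPath := by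
    simp [SimpleGraph.Walk.cons_isPath_iff, hc.ne]
  have h3 := congrArg (fun r : G.Path w c => r.1.length)
    ((hG.subsingleton_path w c).elim ⟨_, h1⟩ ⟨_, h2⟩)
  simp only [SimpleGraph.Walk.length_cons, SimpleGraph.Walk.length_nil] at h3
  have h4 : (q.takeUntil c hcq).length = 0 := by omega
  exact (SimpleGraph.Walk.eq_of_length_eq_zero h4).symm

/-- In an acyclic graph, the start of a path has at most one neighbour on the path. -/
lemma SimpleGraph.IsAcyclic.eq_snd_of_adj [DecidableEq W] {G : SimpleGraph W}
    (hG : G.IsAcyclic) {a b x : W} {q : G.Walk a b} (hq : q.IsPath)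
    (hx : G.Adj a x) (hxq : x ∈ q.support) : x = q.snd := by
  cases q with
  | nil =>
    simp only [SimpleGraph.Walk.support_nil, List.mem_singleton] at hxq
    exact absurd hxq hx.ne'
  | cons h r =>
    rw [SimpleGraph.Walk.cons_isPath_iff] at hq
    rw [SimpleGraph.Walk.support_cons, List.mem_cons] at hxq
    simpa using hG.eq_of_adj_of_mem_support hq.1 hq.2 h hx (hxq.resolve_left hx.ne')

lemma card_adj_sdiff_support [Fintype W] [DecidableEq W] {T : W → W → Bool}
    (hT : Antidirected T) (hG : (underG T).IsAcyclic) {a b : W} {q : (underG T).Walk a b}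
    (hq : q.IsPath) :
    totalDeg T a ≤ ((outNbr T a ∪ inNbr T a) \ q.support.toFinset).card + 1 := by
  rw [← card_outNbr_union_inNbr hT a,
    ← card_sdiff_add_card_inter (outNbr T a ∪ inNbr T a) q.support.toFinset]
  have : ((outNbr T a ∪ inNbr T a) ∩ q.support.toFinset) ⊆ {q.snd} := by
    intro x hx
    rw [mem_inter, mem_outNbr_union_inNbr_s17 hT, List.mem_toFinset] at hx
    exact mem_singleton.2 (hG.eq_snd_of_adj hq hx.1 hx.2)
  have := card_le_card this
  rw [card_singleton] at this
  omega

lemma MinPseudoSemidegGe.le_card_nbr [Fintype V] {A : V → V → Bool} {m : ℕ}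
    (h : MinPseudoSemidegGe A m) {b : Bool} {x y : V} (hy : y ∈ nbr A b x) :
    m ≤ (nbr A b x).card := by
  have hne : (nbr A b x).card ≠ 0 := (card_pos.2 ⟨y, hy⟩).ne'
  cases b
  · exact (h.2.2 x).resolve_left hne
  · exact (h.2.1 x).resolve_left hne

lemma MinPseudoSemidegGe.exists_le_card_nbr [Fintype V] {A : V → V → Bool} {m : ℕ}
    (h : MinPseudoSemidegGe A m) (b : Bool) : ∃ x, m ≤ (nbr A b x).card := by
  obtain ⟨⟨x, y⟩, hxy⟩ := card_pos.1 h.1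
  simp only [mem_filter, mem_univ, true_and] at hxy
  cases b
  · exact ⟨y, h.le_card_nbr (mem_nbr.2 (Or.inr ⟨rfl, hxy⟩))⟩
  · exact ⟨x, h.le_card_nbr (mem_nbr.2 (Or.inl ⟨rfl, hxy⟩))⟩

/-- Short paths of an antidirected tree embed greedily. -/
lemma exists_path_embedding [Fintype V] [DecidableEq V] [Fintype W] [DecidableEq W]
    {A : V → V → Bool} (hA : Loopless A) {m : ℕ} (hmin : MinPseudoSemidegGe A m)
    {T : W → W → Bool} (hT : Antidirected T) (hG : (underG T).IsAcyclic)
    {a b : W} (q : (underG T).Walk a b) (hq : q.IsPath) (hlen : q.length ≤ m) :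
    ∃ f : W → V, Set.InjOn f q.support.toFinset ∧
      (∀ x ∈ q.support, m ≤ (nbr A (vertexSign T x) (f x)).card) ∧
      ∀ x ∈ q.support, ∀ y ∈ q.support, T x y → A (f x) (f y) := by
  induction q with
  | @nil c =>
    obtain ⟨z, hz⟩ := hmin.exists_le_card_nbr (vertexSign T c)
    refine ⟨fun _ => z, by simp, by simpa using hz, ?_⟩
    simp only [SimpleGraph.Walk.support_nil, List.mem_singleton]
    rintro x rfl y rfl h
    exact absurd h fun h => hT _ _ _ h h
  | @cons w c d h r ih =>
    rw [SimpleGraph.Walk.cons_isPath_iff] at hq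
    rw [SimpleGraph.Walk.length_cons] at hlen
    obtain ⟨f, hinj, hdeg, harc⟩ := ih hq.1 (by omega)
    have hcs : c ∈ r.support := r.start_mem_support
    obtain ⟨z, hz, hzr⟩ : ∃ z ∈ nbr A (vertexSign T c) (f c),
        z ∉ r.support.toFinset.image f := by
      by_contra! hcon
      have hsub : nbr A (vertexSign T c) (f c) ⊆ (r.support.toFinset.image f).erase (f c) := by
        intro z hz
        refine mem_erase.2 ⟨?_, hcon z hz⟩
        rintro rfl
        rcases mem_nbr.1 hz with h | h <;> exact hA _ h.2
      have h1 := card_le_card hsub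
      rw [card_erase_of_mem (mem_image_of_mem f (List.mem_toFinset.2 hcs))] at h1
      have h2 : (r.support.toFinset.image f).card ≤ r.length + 1 := by
        rw [← r.length_support]
        exact card_image_le.trans (List.toFinset_card_le _)
      have := hdeg c hcs
      omega
    have hne : ∀ x ∈ r.support, x ≠ w := fun x hx hxw => hq.2 (hxw ▸ hx)
    have hval : ∀ x ∈ r.support, Function.update f w z x = f x := fun x hx =>
      Function.update_of_ne (hne x hx) _ _
    have hzf : ∀ x ∈ r.support, f x ≠ z := fun x hx hxz =>
      hzr (hxz ▸ mem_image_of_mem f (List.mem_toFinset.2 hx))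
    have hsign : vertexSign T w = !vertexSign T c := by
      have h' := h
      rw [underG, SimpleGraph.fromRel_adj] at h'
      rcases h'.2 with h' | h' <;> rw [vertexSign_tail h', vertexSign_head hT h'] <;> rfl
    refine ⟨Function.update f w z, ?_, ?_, ?_⟩
    · intro x hx y hy hxy
      simp only [SimpleGraph.Walk.support_cons, List.coe_toFinset, List.mem_cons,
        Set.mem_ofPred_eq] at hx hy
      rcases hx with rfl | hx <;> rcases hy with rfl | hy
      · rfl
      · rw [hval y hy, Function.update_self] at hxy
        exact absurd hxy.symm (hzf y hy)
      · rw [hval x hx, Function.update_self] at hxy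
        exact absurd hxy (hzf x hx)
      · rw [hval x hx, hval y hy] at hxy
        exact hinj (by simpa using hx) (by simpa using hy) hxy
    · intro x hx
      rw [SimpleGraph.Walk.support_cons, List.mem_cons] at hx
      rcases hx with rfl | hx
      · rw [Function.update_self]
        refine hmin.le_card_nbr (y := f c) ?_
        rw [mem_nbr, hsign]
        rcases mem_nbr.1 hz with h | h <;> simp [h.1, h.2]
      · rw [hval x hx]
        exact hdeg x hx
    · intro x hx y hy hxy
      rw [SimpleGraph.Walk.support_cons, List.mem_cons] at hx hy
      rcases hx with rfl | hx <;> rcases hy with rfl | hy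
      · exact absurd hxy fun h => hT _ _ _ h h
      · obtain rfl := hG.eq_of_adj_of_mem_support hq.1 hq.2 h (underG_adj_of_arc hT hxy) hy
        rw [hval _ hy, Function.update_self]
        rw [mem_nbr, vertexSign_head hT hxy] at hz
        simpa using hz
      · obtain rfl := hG.eq_of_adj_of_mem_support hq.1 hq.2 h
          (underG_adj_of_arc hT hxy).symm hx
        rw [hval _ hx, Function.update_self]
        rw [mem_nbr, vertexSign_tail hxy] at hz
        simpa using hz
      · rw [hval x hx, hval y hy]
        exact harc x hx y hy hxy

/-- Two sets that satisfy Hall's condition can be injected disjointly into two targets. -/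
lemma exists_injOn_union [DecidableEq V] [DecidableEq W] [Nonempty V] {L M : Finset W}
    {X Y : Finset V} (hLM : Disjoint L M) (hL : L.card ≤ X.card) (hM : M.card ≤ Y.card)
    (hXY : L.card + M.card ≤ (X ∪ Y).card) :
    ∃ g : W → V, Set.InjOn g ↑(L ∪ M) ∧ (∀ x ∈ L, g x ∈ X) ∧ ∀ x ∈ M, g x ∈ Y := by
  classical
  let t : ↥(L ∪ M) → Finset V := fun x => if x.1 ∈ L then X else Y
  have hall : ∀ s : Finset ↥(L ∪ M), s.card ≤ (s.biUnion t).card := by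
    intro s
    have hs : s.card = (s.map (Function.Embedding.subtype _)).card := (card_map _).symm
    by_cases h1 : ∃ x ∈ s, x.1 ∈ L
    · by_cases h2 : ∃ x ∈ s, x.1 ∉ L
      · obtain ⟨x, hx, hxL⟩ := h1
        obtain ⟨y, hy, hyL⟩ := h2
        have hX : X ∪ Y ⊆ s.biUnion t := by
          refine union_subset ?_ ?_
          · simpa [t, hxL] using subset_biUnion_of_mem t hx
          · simpa [t, hyL] using subset_biUnion_of_mem t hy
        have hsub : s.map (Function.Embedding.subtype _) ⊆ L ∪ M := by
          intro x hx
          simp only [mem_map, Function.Embedding.subtype_apply] at hx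
          obtain ⟨y, -, rfl⟩ := hx
          exact y.2
        rw [hs]
        exact ((card_le_card hsub).trans (card_union_le L M)).trans
          (hXY.trans (card_le_card hX))
      · push Not at h2
        obtain ⟨x, hx, hxL⟩ := h1
        have hX : X ⊆ s.biUnion t := by
          simpa [t, hxL] using subset_biUnion_of_mem t hx
        have hsub : s.map (Function.Embedding.subtype _) ⊆ L := by
          intro x hx
          simp only [mem_map, Function.Embedding.subtype_apply] at hx
          obtain ⟨y, hy, rfl⟩ := hx
          exact h2 y hy
        rw [hs]
        exact (card_le_card hsub).trans (hL.trans (card_le_card hX))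
    · push Not at h1
      rcases s.eq_empty_or_nonempty with rfl | ⟨x, hx⟩
      · simp
      have hY : Y ⊆ s.biUnion t := by
        simpa [t, h1 x hx] using subset_biUnion_of_mem t hx
      have hsub : s.map (Function.Embedding.subtype _) ⊆ M := by
        intro x hx
        simp only [mem_map, Function.Embedding.subtype_apply] at hx
        obtain ⟨y, hy, rfl⟩ := hx
        exact (mem_union.1 y.2).resolve_left (h1 y hy)
      rw [hs]
      exact (card_le_card hsub).trans (hM.trans (card_le_card hY))
  obtain ⟨g, hg, hgt⟩ := (all_card_le_biUnion_card_iff_exists_injective t).1 hall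
  have hval : ∀ x (hx : x ∈ L ∪ M),
      (if h : x ∈ L ∪ M then g ⟨x, h⟩ else Classical.arbitrary V) = g ⟨x, hx⟩ :=
    fun x hx => dif_pos hx
  refine ⟨fun x => if h : x ∈ L ∪ M then g ⟨x, h⟩ else Classical.arbitrary V, ?_, ?_, ?_⟩
  · intro x hx y hy hxy
    simp only [hval x hx, hval y hy] at hxy
    exact congrArg Subtype.val (hg hxy)
  · intro x hx
    have h := hgt ⟨x, mem_union_left M hx⟩
    simp only [t, if_pos hx] at h
    simpa only [hval x (mem_union_left M hx)] using h
  · intro x hx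
    have h := hgt ⟨x, mem_union_right L hx⟩
    simp only [t, if_neg (disjoint_right.1 hLM hx)] at h
    simpa only [hval x (mem_union_right L hx)] using h

lemma K2sFree.card_nbr_inter_lt [Fintype V] [DecidableEq V] {A : V → V → Bool} {s : ℕ}
    (hfree : K2sFree A s) (hA : Loopless A) {a b : V} (hab : a ≠ b) (sa sb : Bool) :
    (nbr A sa a ∩ nbr A sb b).card < s := by
  by_contra! h
  obtain ⟨R, hR, hcard⟩ := exists_subset_card_eq h
  have hself : ∀ (c : V) (sc : Bool), c ∉ nbr A sc c := by
    intro c sc hc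
    rcases mem_nbr.1 hc with h | h <;> exact hA _ h.2
  exact hfree ⟨a, b, sa, sb, R, hab, hcard,
    fun ha => hself a sa (mem_inter.1 (hR ha)).1,
    fun hb => hself b sb (mem_inter.1 (hR hb)).2, hR⟩

end Broom

/-- (Part of Case A of Lemma `lemma:thirdpart2`.) If the double broom
`B_uv(T)` has at most `3k/4` vertices, it embeds in the subdigraph `D'` (on vertex set
`S`) of a `𝒦_{2,s}`-free digraph `D`, where `D'` has minimum pseudo-semidegree at least
`⌈k/2⌉`. -/
theorem stmt_17 (k : ℕ) (hk : 0 < k)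
    {V : Type*} [Fintype V] [DecidableEq V]
    (D : V → V → Bool) (hloop : Loopless D)
    (hfree : K2sFree D ((k + 11) / 12))
    (S : Finset V) (D' : V → V → Bool) (hsub : SubdigraphOn D S D')
    (hmin : MinPseudoSemidegGe D' ((k + 1) / 2))
    {W : Type*} [Fintype W] [DecidableEq W]
    (T : W → W → Bool) (hT : Antidirected T)
    (htree : (underG T).IsTree) (hkT : arcCount T = k)
    (u v : W) (huv : u ≠ v)
    (huOut : 0 < (outNbr T u).card) (hu : (outNbr T u).card = maxDeg T)
    (hv : totalDeg T v = secondMaxDeg T) (hD2 : k / 4 + 3 ≤ secondMaxDeg T)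
    (p : (underG T).Walk u v) (hp : p.IsPath)
    (hsize : 4 * (broomSet T p).card ≤ 3 * k) :
    ∃ f : W → V, Set.InjOn f ↑(broomSet T p) ∧ (∀ x ∈ broomSet T p, f x ∈ S) ∧
      ∀ x ∈ broomSet T p, ∀ y ∈ broomSet T p, T x y → D' (f x) (f y) := by
  have hG : (underG T).IsAcyclic := htree.isAcyclic
  have hA : Loopless D' := fun x hx => hloop x (hsub x x hx).1
  set m := (k + 1) / 2 with hm
  set P := p.support.toFinset with hP
  set L := (outNbr T u ∪ inNbr T u) \ P with hL
  set M := (outNbr T v ∪ inNbr T v) \ P with hM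
  have memL : ∀ x, x ∈ L ↔ (underG T).Adj u x ∧ x ∉ P := fun x => by
    rw [hL, mem_sdiff, mem_outNbr_union_inNbr_s17 hT]
  have memM : ∀ x, x ∈ M ↔ (underG T).Adj v x ∧ x ∉ P := fun x => by
    rw [hM, mem_sdiff, mem_outNbr_union_inNbr_s17 hT]
  have memP : ∀ x, x ∈ P ↔ x ∈ p.support := fun x => List.mem_toFinset
  have memP' : ∀ x, x ∈ P ↔ x ∈ p.reverse.support := fun x => by simp [hP]
  have huP : u ∈ P := (memP u).2 p.start_mem_support
  have hvP : v ∈ P := (memP v).2 p.end_mem_support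
  have adjL : ∀ x ∈ L, ∀ y ∈ P, (underG T).Adj x y → y = u := fun x hx y hy hxy =>
    hG.eq_of_adj_of_mem_support hp (fun h => ((memL x).1 hx).2 ((memP x).2 h))
      ((memL x).1 hx).1.symm hxy ((memP y).1 hy)
  have adjM : ∀ x ∈ M, ∀ y ∈ P, (underG T).Adj x y → y = v := fun x hx y hy hxy =>
    hG.eq_of_adj_of_mem_support hp.reverse (fun h => ((memM x).1 hx).2 ((memP' x).2 h))
      ((memM x).1 hx).1.symm hxy ((memP' y).1 hy)
  have hLM : Disjoint L M := disjoint_left.2 fun x hx hx' =>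
    huv (adjL x hx v hvP ((memM x).1 hx').1.symm).symm
  have star : ∀ a x y, (underG T).Adj a x → (underG T).Adj a y → ¬ T x y := by
    intro a x y hax hay hxy
    rw [underG, SimpleGraph.fromRel_adj] at hax hay
    rcases hax.2 with h | h
    · exact hT _ _ _ h hxy
    rcases hay.2 with h' | h'
    · exact hT _ _ _ h h'
    · exact hT _ _ _ hxy h'
  have cross : ∀ x ∈ L, ∀ y ∈ M, ¬ (underG T).Adj x y := by
    intro x hx y hy hxy
    have hxp : x ∉ p.support := fun h => ((memL x).1 hx).2 ((memP x).2 h)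
    have hq := (hp.cons hxp (h := ((memL x).1 hx).1.symm)).reverse
    have hyq : y ∉ (SimpleGraph.Walk.cons ((memL x).1 hx).1.symm p).reverse.support := by
      have := ((memM y).1 hy).2
      rw [memP] at this
      have hyu : y ≠ u := fun h => this (h ▸ p.start_mem_support)
      simp [hxy.ne', this, hyu]
    have := hG.eq_of_adj_of_mem_support hq hyq ((memM y).1 hy).1.symm hxy.symm (by simp)
    exact ((memL x).1 hx).2 (this ▸ hvP)
  have hB : broomSet T p = P ∪ (L ∪ M) := by
    ext x
    simp only [broomSet, hL, hM, ← hP, mem_union, mem_sdiff]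
    tauto
  have hPLM : Disjoint P (L ∪ M) := disjoint_left.2 fun x hx hx' =>
    (mem_union.1 hx').elim (fun h => ((memL x).1 h).2 hx) fun h => ((memM x).1 h).2 hx
  have hPcard : P.card = p.length + 1 := by
    rw [hP, List.toFinset_card_of_nodup hp.support_nodup, p.length_support]
  have hBcard : (broomSet T p).card = p.length + 1 + (L.card + M.card) := by
    rw [hB, card_union_of_disjoint hPLM, card_union_of_disjoint hLM, hPcard]
  have hLcard : totalDeg T u ≤ L.card + 1 := card_adj_sdiff_support hT hG hp
  have hMcard : totalDeg T v ≤ M.card + 1 := by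
    have := card_adj_sdiff_support hT hG hp.reverse
    rwa [SimpleGraph.Walk.support_reverse, List.toFinset_reverse] at this
  have hdeg : totalDeg T v ≤ totalDeg T u := by
    have h1 : totalDeg T v ≤ maxDeg T := le_sup (f := totalDeg T) (mem_univ v)
    have h2 : (outNbr T u).card ≤ totalDeg T u := Nat.le_add_right _ _
    omega
  obtain ⟨f, finj, fdeg, farc⟩ := exists_path_embedding hA hmin hT hG p hp (by omega)
  have fne : f u ≠ f v := fun h => huv (finj (mem_coe.2 huP) (mem_coe.2 hvP) h)
  set Nu := nbr D' (vertexSign T u) (f u) with hNu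
  set Nv := nbr D' (vertexSign T v) (f v) with hNv
  have hNum : m ≤ Nu.card := fdeg u p.start_mem_support
  have hNvm : m ≤ Nv.card := fdeg v p.end_mem_support
  have hQ : (P.image f).card = p.length + 1 := by rw [card_image_of_injOn finj, hPcard]
  have off : ∀ a ∈ P, ∀ b : Bool,
      (nbr D' b (f a)).card ≤ (nbr D' b (f a) \ P.image f).card + p.length := by
    intro a ha b
    have hs : nbr D' b (f a) ∩ P.image f ⊆ (P.image f).erase (f a) := by
      intro z hz
      refine mem_erase.2 ⟨?_, (mem_inter.1 hz).2⟩
      rintro rfl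
      rcases mem_nbr.1 (mem_inter.1 hz).1 with h | h <;> exact hA _ h.2
    have h1 := card_le_card hs
    rw [card_erase_of_mem (mem_image_of_mem f ha)] at h1
    have h2 := card_sdiff_add_card_inter (nbr D' b (f a)) (P.image f)
    omega
  have hX : L.card ≤ (Nu \ P.image f).card := by
    have : Nu.card ≤ (Nu \ P.image f).card + p.length := off u huP (vertexSign T u)
    omega
  have hY : M.card ≤ (Nv \ P.image f).card := by
    have : Nv.card ≤ (Nv \ P.image f).card + p.length := off v hvP (vertexSign T v)
    omega
  have hnbr : ∀ b x, nbr D' b x ⊆ nbr D b x := by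
    intro b x z hz
    rw [mem_nbr] at hz ⊢
    exact hz.imp (fun h => ⟨h.1, (hsub _ _ h.2).1⟩) fun h => ⟨h.1, (hsub _ _ h.2).1⟩
  have hXY : L.card + M.card ≤ ((Nu \ P.image f) ∪ (Nv \ P.image f)).card := by
    rw [← union_sdiff_distrib]
    have h1 := hfree.card_nbr_inter_lt hloop fne (vertexSign T u) (vertexSign T v)
    have h2 : (Nu ∩ Nv).card ≤ _ := card_le_card (inter_subset_inter (hnbr _ _) (hnbr _ _))
    have h3 := card_union_add_card_inter Nu Nv
    have h4 := le_card_sdiff (P.image f) (Nu ∪ Nv)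
    omega
  have : Nonempty V := ⟨f u⟩
  obtain ⟨g, ginj, gL, gM⟩ := exists_injOn_union hLM hX hY hXY
  have gP : ∀ x ∈ L ∪ M, g x ∉ P.image f := fun x hx =>
    (mem_union.1 hx).elim (fun h => (mem_sdiff.1 (gL x h)).2) fun h => (mem_sdiff.1 (gM x h)).2
  have memS : ∀ b x y, y ∈ nbr D' b x → x ∈ S ∧ y ∈ S := by
    intro b x y h
    rcases mem_nbr.1 h with h | h
    · exact (hsub _ _ h.2).2
    · exact (hsub _ _ h.2).2.symm
  let F : W → V := fun x => if x ∈ P then f x else g x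
  have FP : ∀ x ∈ P, F x = f x := fun x hx => if_pos hx
  have FLM : ∀ x ∈ L ∪ M, F x = g x := fun x hx => if_neg (disjoint_right.1 hPLM hx)
  have FL : ∀ x ∈ L, F x ∈ Nu := fun x hx => by
    rw [FLM x (mem_union_left M hx)]
    exact (mem_sdiff.1 (gL x hx)).1
  have FM : ∀ x ∈ M, F x ∈ Nv := fun x hx => by
    rw [FLM x (mem_union_right L hx)]
    exact (mem_sdiff.1 (gM x hx)).1
  have arc_out : ∀ a y z, T a y → z ∈ nbr D' (vertexSign T a) (f a) → D' (f a) z := by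
    intro a y z h hz
    rw [mem_nbr, vertexSign_tail h] at hz
    simpa using hz
  have arc_in : ∀ a y z, T y a → z ∈ nbr D' (vertexSign T a) (f a) → D' z (f a) := by
    intro a y z h hz
    rw [mem_nbr, vertexSign_head hT h] at hz
    simpa using hz
  rw [hB]
  refine ⟨F, ?_, ?_, ?_⟩
  · intro x hx y hy hxy
    rcases mem_union.1 (mem_coe.1 hx) with hx | hx <;>
      rcases mem_union.1 (mem_coe.1 hy) with hy | hy
    · rw [FP x hx, FP y hy] at hxy
      exact finj hx hy hxy
    · rw [FP x hx, FLM y hy] at hxy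
      exact absurd (hxy ▸ mem_image_of_mem f hx) (gP y hy)
    · rw [FLM x hx, FP y hy] at hxy
      exact absurd (hxy ▸ mem_image_of_mem f hy) (gP x hx)
    · rw [FLM x hx, FLM y hy] at hxy
      exact ginj hx hy hxy
  · intro x hx
    rcases mem_union.1 hx with hx | hx
    · obtain ⟨z, hz⟩ := card_pos.1
        (lt_of_lt_of_le (show 0 < m by omega) (fdeg x ((memP x).1 hx)))
      rw [FP x hx]
      exact (memS _ _ _ hz).1
    · rcases mem_union.1 hx with hx | hx
      · exact (memS _ _ _ (FL x hx)).2
      · exact (memS _ _ _ (FM x hx)).2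
  · intro x hx y hy hxy
    have hadj := underG_adj_of_arc hT hxy
    simp only [mem_union] at hx hy
    rcases hx with hx | hx | hx <;> rcases hy with hy | hy | hy
    · rw [FP x hx, FP y hy]
      exact farc x ((memP x).1 hx) y ((memP y).1 hy) hxy
    · obtain rfl := adjL y hy x hx hadj.symm
      rw [FP x hx]
      exact arc_out x y _ hxy (FL y hy)
    · obtain rfl := adjM y hy x hx hadj.symm
      rw [FP x hx]
      exact arc_out x y _ hxy (FM y hy)
    · obtain rfl := adjL x hx y hy hadj
      rw [FP y hy]
      exact arc_in y x _ hxy (FL x hx)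
    · exact absurd hxy (star u x y ((memL x).1 hx).1 ((memL y).1 hy).1)
    · exact absurd hadj (cross x hx y hy)
    · obtain rfl := adjM x hx y hy hadj
      rw [FP y hy]
      exact arc_in y x _ hxy (FM x hx)
    · exact absurd hadj.symm (cross y hy x hx)
    · exact absurd hxy (star v x y ((memM x).1 hx).1 ((memM y).1 hy).1)
end
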